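/- arXiv:2002.11809 — 2 statements merged into one kernel-verified Lean document; each statement's English description precedes it below -/
import Mathlib

section
/- Suppose m,n → ∞ with m/n → μ ∈ (0,∞), P^{(n)} → P weakly for some probability measure P on ℤ_+ × [0,1], and P^{(n)}_{10} → P_{10} ∈ (0,∞). Then the model degree distribution of G_n, f_n(s) = P(deg_{G_n}(1) = s), converges weakly to the compound Poisson distribution with rate μP_{10} and increment distribution g, i.e., to the law of Σ_{k=1}^Λ H_k, where Λ, H_1, H_2, … are independent, Λ ~ Poi(μP_{10}), and each H_k has probability mass function g(s) = ∫ Bin(x−1,y)(s) · x P(dx,dy)/P_{10}. -/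
open MeasureTheory ProbabilityTheory Filter
open scoped ENNReal Topology Classical

noncomputable section

/-- The binomial probability mass function `Bin(x,y)(s)`. -/
def binP (x : ℕ) (y : ℝ) (s : ℕ) : ℝ := (x.choose s : ℝ) * y ^ s * (1 - y) ^ (x - s)

/-- Convolution of (mass) functions on `ℕ`. -/
def conv (f g : ℕ → ℝ) (s : ℕ) : ℝ := ∑ i ∈ Finset.range (s + 1), f i * g (s - i)

/-- Iterated convolution power: `convPow f j` is the `j`-fold convolution of `f`. -/
def convPow (f : ℕ → ℝ) : ℕ → ℕ → ℝ
  | 0 => fun s => if s = 0 then 1 else 0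
  | j + 1 => conv f (convPow f j)

/-- The compound Poisson probability mass function `CPoi(lam, f)`, i.e. the law of
`H_1 + ⋯ + H_Λ` where `Λ ~ Poi(lam)` and the `H_k` are i.i.d. with mass function `f`,
independent of `Λ`. -/
def cpoi (lam : ℝ) (f : ℕ → ℝ) (s : ℕ) : ℝ :=
  ∑' j : ℕ, Real.exp (-lam) * lam ^ j / (j.factorial : ℝ) * convPow f j s

/-- Convolution of (mass) functions on `ℕ × ℕ`. -/
def conv2 (F G : ℕ → ℕ → ℝ) (s t : ℕ) : ℝ :=
  ∑ i ∈ Finset.range (s + 1), ∑ j ∈ Finset.range (t + 1), F i j * G (s - i) (t - j)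

/-- Point mass at `(1,1)`, as a mass function on `ℕ × ℕ`. -/
def delta11 (s t : ℕ) : ℝ := if s = 1 ∧ t = 1 then 1 else 0

/-- The cross moment `Q_{rs} = E[(X)_r Y^s]` of a layer type distribution `Q`,
where `(x)_r` is the falling factorial. -/
def mom (Q : Measure (ℕ × ℝ)) (r s : ℕ) : ℝ :=
  ∫ p, (p.1.descFactorial r : ℝ) * p.2 ^ s ∂Q

/-- The increment distribution `g(s) = ∫ Bin(x-1,y)(s) x P(dx,dy) / P₁₀`. -/
def gInc (P : Measure (ℕ × ℝ)) (s : ℕ) : ℝ :=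
  (∫ p, (p.1 : ℝ) * binP (p.1 - 1) p.2 s ∂P) / mom P 1 0

/-- The limiting degree distribution `\bar f_1 = CPoi(μ P₁₀, g)`. -/
def barf1 (mu : ℝ) (P : Measure (ℕ × ℝ)) (s : ℕ) : ℝ :=
  cpoi (mu * mom P 1 0) (gInc P) s

/-- The distribution `f₂'` of `(D₁', D₂')`:
`f₂'(s,t) = ∫ Bin(x-2,y)(s) Bin(x-2,y)(t) (x)₂ y P(dx,dy) / P₂₁`. -/
def f2p (P : Measure (ℕ × ℝ)) (s t : ℕ) : ℝ :=
  (∫ p, (p.1.descFactorial 2 : ℝ) * p.2 * binP (p.1 - 2) p.2 s * binP (p.1 - 2) p.2 t ∂P) /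
    mom P 2 1

/-- The limiting bidegree distribution `\bar f₂ = δ₍₁,₁₎ ∗ (\bar f₁ ⊗ \bar f₁) ∗ f₂'`. -/
def barf2 (mu : ℝ) (P : Measure (ℕ × ℝ)) : ℕ → ℕ → ℝ :=
  conv2 (conv2 delta11 fun s t => barf1 mu P s * barf1 mu P t) (f2p P)

instance (n : ℕ) : MeasurableSpace (Finset (Fin n)) := ⊤

/-- Bernoulli distribution on `Bool` with success probability `y` (truncated into `[0,1]`). -/
def bern (y : ℝ) : Measure Bool :=
  (PMF.bernoulli (min (Real.toNNReal y) 1) (min_le_right _ _)).toMeasure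

instance (y : ℝ) : IsProbabilityMeasure (bern y) :=
  PMF.toMeasure.isProbabilityMeasure _

/-- The distribution of the indicator of one potential edge `e` of a layer with node set `V`
and strength `y`: Bernoulli(`y`) if `e` is a non-loop pair inside `V`, and surely absent
otherwise. -/
def edgeFactor (n : ℕ) (V : Finset (Fin n)) (y : ℝ) (e : Sym2 (Fin n)) : Measure Bool :=
  if ¬ e.IsDiag ∧ ∀ v ∈ e, v ∈ V then bern y else Measure.dirac false

instance (n : ℕ) (V : Finset (Fin n)) (y : ℝ) (e : Sym2 (Fin n)) :
    IsProbabilityMeasure (edgeFactor n V y e) := by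
  unfold edgeFactor; split <;> infer_instance

/-- Conditionally on the node set `V` and strength `y`, each non-loop pair of nodes of `V`
is linked independently with probability `y`. -/
def edgeMeasure (n : ℕ) (V : Finset (Fin n)) (y : ℝ) : Measure (Sym2 (Fin n) → Bool) :=
  Measure.pi fun e => edgeFactor n V y e

/-- Uniformly random subset of the `n` nodes of size `x`. -/
def vertexMeasure (n x : ℕ) : Measure (Finset (Fin n)) :=
  if h : (Finset.powersetCard x (Finset.univ : Finset (Fin n))).Nonempty then
    (PMF.uniformOfFinset _ h).toMeasure
  else Measure.dirac ∅

/-- A sampled layer: its type `(x,y)`, its node set, and its edge indicators. -/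
abbrev Layer (n : ℕ) := (ℕ × ℝ) × Finset (Fin n) × (Sym2 (Fin n) → Bool)

/-- The distribution of a single layer with type distribution `Q`: the type `(x,y)` is
sampled from `Q`; conditionally on it, the node set is a uniformly random subset of size
`x` of the `n` nodes, and each pair of nodes of the node set is linked independently with
probability `y`. -/
def layerMeasure (n : ℕ) (Q : Measure (ℕ × ℝ)) : Measure (Layer n) :=
  Q.bind fun xy =>
    (vertexMeasure n xy.1).bind fun V =>
      (edgeMeasure n V xy.2).map fun f => (xy, V, f)

instance (n x : ℕ) : IsProbabilityMeasure (vertexMeasure n x) := by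
  unfold vertexMeasure; split <;> infer_instance

instance (n : ℕ) (V : Finset (Fin n)) (y : ℝ) : IsProbabilityMeasure (edgeMeasure n V y) := by
  unfold edgeMeasure; infer_instance

theorem measure_bind_univ_le {α β : Type*} [MeasurableSpace α] [MeasurableSpace β]
    (Q : Measure α) [IsProbabilityMeasure Q] {f : α → Measure β}
    (hf : ∀ a, f a Set.univ ≤ 1) : Q.bind f Set.univ ≤ 1 := by
  rw [Measure.bind, Measure.join_apply MeasurableSet.univ]
  by_cases hmeas : AEMeasurable f Q
  · rw [lintegral_map' (Measure.measurable_coe MeasurableSet.univ).aemeasurable hmeas]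
    calc ∫⁻ a, f a Set.univ ∂Q ≤ ∫⁻ _, 1 ∂Q := lintegral_mono hf
      _ = 1 := by simp
  · rw [Measure.map_of_not_aemeasurable hmeas]; simp

instance (n : ℕ) (Q : Measure (ℕ × ℝ)) [IsProbabilityMeasure Q] :
    IsFiniteMeasure (layerMeasure n Q) := by
  refine ⟨lt_of_le_of_lt ?_ ENNReal.one_lt_top⟩
  refine measure_bind_univ_le Q fun xy => ?_
  refine measure_bind_univ_le _ fun V => ?_
  have hg : Measurable fun f : Sym2 (Fin n) → Bool => ((xy, V, f) : Layer n) :=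
    measurable_const.prodMk (measurable_const.prodMk measurable_id)
  rw [Measure.map_apply hg MeasurableSet.univ]
  simp

/-- The Bernoulli random graph superposition model `G_n` with `n` nodes and `m` mutually
independent layers, each with type distribution `Q`. -/
def modelMeasure (n m : ℕ) (Q : Measure (ℕ × ℝ)) [IsProbabilityMeasure Q] :
    Measure (Fin m → Layer n) :=
  Measure.pi fun _ => layerMeasure n Q

/-- The edge set `E(G_{n,k})` of one layer. -/
def layerEdges {n : ℕ} (L : Layer n) : Finset (Sym2 (Fin n)) :=
  Finset.univ.filter fun e => L.2.2 e = true ∧ ¬ e.IsDiag ∧ ∀ v ∈ e, v ∈ L.2.1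

/-- The edge set `E(G_n) = ⋃ₖ E(G_{n,k})` of the superposition graph. -/
def graphEdges {n m : ℕ} (ω : Fin m → Layer n) : Finset (Sym2 (Fin n)) :=
  Finset.univ.biUnion fun k => layerEdges (ω k)

/-- The degree `deg_{G_n}(i)` of the node with label `i` (labels start from `0`). -/
def deg {n m : ℕ} (ω : Fin m → Layer n) (i : ℕ) : ℕ :=
  ((graphEdges ω).filter fun e => ∃ v : Fin n, v ∈ e ∧ (v : ℕ) = i).card

/-- The event that the first two nodes (labels `0` and `1`) are adjacent in `G_n`. -/
def adjEvent (n m : ℕ) : Set (Fin m → Layer n) :=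
  {ω | ∃ e ∈ graphEdges ω, (∃ v : Fin n, v ∈ e ∧ (v : ℕ) = 0) ∧ ∃ v : Fin n, v ∈ e ∧ (v : ℕ) = 1}

/-- The model bidegree distribution
`f_{2,n}(s,t) = P(deg(1) = s, deg(2) = t ∣ {1,2} ∈ E(G_n))`. -/
def bidegree (n m : ℕ) (Q : Measure (ℕ × ℝ)) [IsProbabilityMeasure Q] (s t : ℕ) : ℝ :=
  ((modelMeasure n m Q)[|adjEvent n m] {ω | deg ω 0 = s ∧ deg ω 1 = t}).toReal

theorem coeff_mk_pow_eq_convPow (f : ℕ → ℝ) (j s : ℕ) :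
    PowerSeries.coeff s (PowerSeries.mk f ^ j) = convPow f j s := by
  induction j generalizing s with
  | zero => simp [convPow, PowerSeries.coeff_one]
  | succ j ih =>
    rw [pow_succ', PowerSeries.coeff_mul, convPow, conv,
      Finset.Nat.sum_antidiagonal_eq_sum_range_succ_mk]
    simp [ih]

theorem convPow_mixture (a b : ℝ) (g : ℕ → ℝ) (m s : ℕ) :
    convPow (fun t => a * (if t = 0 then 1 else 0) + b * g t) m s =
      ∑ j ∈ Finset.range (m + 1), (m.choose j : ℝ) * b ^ j * a ^ (m - j) * convPow g j s := by
  have h : PowerSeries.mk (fun t => a * (if t = 0 then 1 else 0) + b * g t) =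
      PowerSeries.C b * PowerSeries.mk g + PowerSeries.C a := by
    ext t
    simp only [PowerSeries.coeff_mk, map_add, PowerSeries.coeff_C_mul, PowerSeries.coeff_C]
    split_ifs <;> ring
  rw [← coeff_mk_pow_eq_convPow, h, add_pow, map_sum]
  refine Finset.sum_congr rfl fun j _ => ?_
  have : (PowerSeries.C b * PowerSeries.mk g) ^ j * PowerSeries.C a ^ (m - j) *
      (m.choose j : PowerSeries ℝ) =
      PowerSeries.C ((m.choose j : ℝ) * b ^ j * a ^ (m - j)) * PowerSeries.mk g ^ j := by
    simp only [map_mul, map_pow, map_natCast]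
    ring
  rw [this, PowerSeries.coeff_C_mul, coeff_mk_pow_eq_convPow]

theorem convPow_nonneg {f : ℕ → ℝ} (h0 : ∀ t, 0 ≤ f t) (j s : ℕ) : 0 ≤ convPow f j s := by
  induction j generalizing s with
  | zero => simp only [convPow]; split_ifs <;> norm_num
  | succ j ih =>
    simp only [convPow, conv]
    exact Finset.sum_nonneg fun i _ => mul_nonneg (h0 i) (ih _)

theorem convPow_le {f : ℕ → ℝ} (h0 : ∀ t, 0 ≤ f t) (h1 : ∀ t, f t ≤ 1) (s j : ℕ) {t : ℕ}
    (ht : t ≤ s) : convPow f j t ≤ ((s : ℝ) + 1) ^ j := by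
  induction j generalizing t with
  | zero => simp only [convPow]; split_ifs <;> norm_num
  | succ j ih =>
    have hs : (0 : ℝ) ≤ (s : ℝ) + 1 := by positivity
    calc convPow f (j + 1) t ≤ ∑ i ∈ Finset.range (t + 1), ((s : ℝ) + 1) ^ j := by
          simp only [convPow, conv]
          refine Finset.sum_le_sum fun i _ => ?_
          calc f i * convPow f j (t - i) ≤ 1 * ((s : ℝ) + 1) ^ j :=
                mul_le_mul (h1 i) (ih (by omega)) (convPow_nonneg h0 _ _) zero_le_one
            _ = _ := one_mul _
      _ = ((t : ℝ) + 1) * ((s : ℝ) + 1) ^ j := by simp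
      _ ≤ ((s : ℝ) + 1) * ((s : ℝ) + 1) ^ j := by gcongr
      _ = _ := (pow_succ' _ _).symm

theorem tendsto_convPow {f : ℕ → ℕ → ℝ} {g : ℕ → ℝ}
    (h : ∀ t, Tendsto (fun n => f n t) atTop (𝓝 (g t))) (j s : ℕ) : Tendsto (fun n => convPow (f n) j s) atTop (𝓝 (convPow g j s)) := by
  induction j generalizing s with
  | zero => exact tendsto_const_nhds
  | succ j ih =>
    simp only [convPow, conv]
    exact tendsto_finsetSum _ fun i _ => (h i).mul (ih _)

theorem tendsto_one_sub_pow_exp {m : ℕ → ℕ} {ε : ℕ → ℝ} {lam : ℝ}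
    (hε : Tendsto ε atTop (𝓝 0))
    (hmε : Tendsto (fun n => (m n : ℝ) * ε n) atTop (𝓝 lam)) :
    Tendsto (fun n => (1 - ε n) ^ m n) atTop (𝓝 (Real.exp (-lam))) := by
  have hlow : Tendsto (fun n => Real.exp (-((m n : ℝ) * ε n / (1 - ε n)))) atTop
      (𝓝 (Real.exp (-lam))) := by
    have := (hmε.div (tendsto_const_nhds.sub hε) (by norm_num : (1 - 0 : ℝ) ≠ 0)).neg
    simp only [sub_zero, div_one] at this
    exact (Real.continuous_exp.tendsto _).comp this
  have hup : Tendsto (fun n => Real.exp (-((m n : ℝ) * ε n))) atTop (𝓝 (Real.exp (-lam))) :=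
    (Real.continuous_exp.tendsto _).comp hmε.neg
  refine tendsto_of_tendsto_of_tendsto_of_le_of_le' hlow hup ?_ ?_
  · filter_upwards [hε.eventually (gt_mem_nhds zero_lt_one)] with n hn
    have hpos : 0 < 1 - ε n := by linarith
    have h1 : Real.exp (-(ε n / (1 - ε n))) ≤ 1 - ε n := by
      rw [Real.exp_neg, inv_le_comm₀ (Real.exp_pos _) hpos]
      have : (1 - ε n)⁻¹ = ε n / (1 - ε n) + 1 := by field_simp; ring
      rw [this]
      exact Real.add_one_le_exp _
    calc Real.exp (-((m n : ℝ) * ε n / (1 - ε n))) = Real.exp (-(ε n / (1 - ε n))) ^ m n := by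
          rw [← Real.exp_nat_mul]; congr 1; ring
      _ ≤ _ := pow_le_pow_left₀ (Real.exp_pos _).le h1 _
  · filter_upwards [hε.eventually (gt_mem_nhds zero_lt_one)] with n hn
    have hpos : 0 ≤ 1 - ε n := by linarith
    calc (1 - ε n) ^ m n ≤ Real.exp (-ε n) ^ m n :=
          pow_le_pow_left₀ hpos (Real.one_sub_le_exp_neg _) _
      _ = _ := by rw [← Real.exp_nat_mul]; congr 1; ring

theorem tendsto_choose_mul_pow_exp {m : ℕ → ℕ} (hm : Tendsto m atTop atTop) {ε : ℕ → ℝ} {lam : ℝ}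
    (hε : Tendsto ε atTop (𝓝 0))
    (hmε : Tendsto (fun n => (m n : ℝ) * ε n) atTop (𝓝 lam)) (j : ℕ) :
    Tendsto (fun n => ((m n).choose j : ℝ) * ε n ^ j * (1 - ε n) ^ (m n - j)) atTop
      (𝓝 (Real.exp (-lam) * lam ^ j / (j.factorial : ℝ))) := by
  have hchoose : Tendsto (fun n => ((m n).choose j : ℝ) * ε n ^ j) atTop
      (𝓝 (lam ^ j / j.factorial)) := by
    have h1 : Tendsto (fun n => ∏ i ∈ Finset.range j, ((m n : ℝ) * ε n - i * ε n)) atTop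
        (𝓝 (∏ i ∈ Finset.range j, (lam - i * 0))) :=
      tendsto_finsetProd _ fun i _ => hmε.sub (hε.const_mul _)
    have h2 := h1.div_const (j.factorial : ℝ)
    simp only [mul_zero, sub_zero, Finset.prod_const, Finset.card_range] at h2
    refine h2.congr' ?_
    filter_upwards [hm.eventually_ge_atTop j] with n hn
    have hd : ((m n).descFactorial j : ℝ) = ∏ i ∈ Finset.range j, ((m n : ℝ) - i) := by
      rw [Nat.descFactorial_eq_prod_range, Nat.cast_prod]
      refine Finset.prod_congr rfl fun i hi => ?_
      rw [Nat.cast_sub (by have := Finset.mem_range.1 hi; omega)]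
    have hc : ((m n).choose j : ℝ) = ((m n).descFactorial j : ℝ) / j.factorial := by
      rw [Nat.descFactorial_eq_factorial_mul_choose, Nat.cast_mul]
      field_simp
    rw [hc, hd, div_mul_eq_mul_div]
    congr 1
    rw [← Finset.card_range j, ← Finset.prod_const, Finset.card_range, ← Finset.prod_mul_distrib]
    exact Finset.prod_congr rfl fun i _ => by ring
  have hpow : Tendsto (fun n => (1 - ε n) ^ (m n - j)) atTop (𝓝 (Real.exp (-lam))) := by
    have h1 := (tendsto_one_sub_pow_exp hε hmε).div
      ((tendsto_const_nhds.sub hε).pow j) (by norm_num : ((1 : ℝ) - 0) ^ j ≠ 0)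
    simp only [sub_zero, one_pow, div_one] at h1
    refine h1.congr' ?_
    filter_upwards [hm.eventually_ge_atTop j, hε.eventually (gt_mem_nhds zero_lt_one)] with n hn hn'
    rw [Pi.div_apply, pow_sub₀ _ (sub_ne_zero.2 hn'.ne') hn, div_eq_mul_inv]
  have := hchoose.mul hpow
  rwa [div_mul_eq_mul_div, mul_comm (lam ^ j)] at this

theorem tendsto_convPow_mixture {m : ℕ → ℕ} (hm : Tendsto m atTop atTop) {ε : ℕ → ℝ} {lam : ℝ}
    (hε0 : ∀ n, 0 ≤ ε n) (hε : Tendsto ε atTop (𝓝 0))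
    (hmε : Tendsto (fun n => (m n : ℝ) * ε n) atTop (𝓝 lam))
    {f : ℕ → ℕ → ℝ} {g : ℕ → ℝ} (h0 : ∀ n t, 0 ≤ f n t) (h1 : ∀ n t, f n t ≤ 1)
    (h : ∀ t, Tendsto (fun n => f n t) atTop (𝓝 (g t))) (s : ℕ) :
    Tendsto (fun n => convPow (fun t => (1 - ε n) * (if t = 0 then 1 else 0) + ε n * f n t) (m n) s)
      atTop (𝓝 (cpoi lam g s)) := by
  have hsum : ∀ n, convPow (fun t => (1 - ε n) * (if t = 0 then 1 else 0) + ε n * f n t) (m n) s =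
      ∑' j, ((m n).choose j : ℝ) * ε n ^ j * (1 - ε n) ^ (m n - j) * convPow (f n) j s := by
    intro n
    rw [convPow_mixture, tsum_eq_sum]
    intro j hj
    rw [Nat.choose_eq_zero_of_lt (by simpa using hj)]
    simp
  simp_rw [hsum, cpoi]
  refine tendsto_tsum_of_dominated_convergence
    (bound := fun j => ((lam + 1) * ((s : ℝ) + 1)) ^ j / (j.factorial : ℝ))
    (Real.summable_pow_div_factorial _)
    (fun j => (tendsto_choose_mul_pow_exp hm hε hmε j).mul (tendsto_convPow h j s))
    ?_
  filter_upwards [hε.eventually (gt_mem_nhds zero_lt_one),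
    hmε.eventually (gt_mem_nhds (lt_add_one lam))] with n hn hn' j
  have hs : (0 : ℝ) ≤ (s : ℝ) + 1 := by positivity
  have h1e : 0 ≤ 1 - ε n := by linarith
  have hc := convPow_nonneg (h0 n) j s
  rw [Real.norm_of_nonneg (by have := hε0 n; positivity)]
  have hle : (1 - ε n) ^ (m n - j) ≤ 1 := pow_le_one₀ h1e (by linarith [hε0 n])
  have hch : ((m n).choose j : ℝ) * ε n ^ j ≤ (lam + 1) ^ j / j.factorial := by
    calc ((m n).choose j : ℝ) * ε n ^ j ≤ ((m n : ℝ) ^ j / j.factorial) * ε n ^ j :=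
          mul_le_mul_of_nonneg_right (Nat.choose_le_pow_div _ _) (pow_nonneg (hε0 n) _)
      _ = ((m n : ℝ) * ε n) ^ j / j.factorial := by rw [mul_pow]; ring
      _ ≤ _ := by
        have := hε0 n
        gcongr
  calc ((m n).choose j : ℝ) * ε n ^ j * (1 - ε n) ^ (m n - j) * convPow (f n) j s
      ≤ ((lam + 1) ^ j / j.factorial) * 1 * ((s : ℝ) + 1) ^ j := by
        have h3 := convPow_le (h0 n) (h1 n) s j le_rfl
        have h4 : 0 ≤ ((m n).choose j : ℝ) * ε n ^ j := by have := hε0 n; positivity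
        exact mul_le_mul (mul_le_mul hch hle (by positivity) (h4.trans hch)) h3 hc
          (by rw [mul_one]; exact h4.trans hch)
    _ = _ := by rw [mul_pow]; ring

theorem binP_nonneg (x s : ℕ) {y : ℝ} (hy : y ∈ Set.Icc (0 : ℝ) 1) : 0 ≤ binP x y s := by
  have h0 := hy.1
  have h1 : 0 ≤ 1 - y := by linarith [hy.2]
  unfold binP
  positivity

theorem binP_le_one (x s : ℕ) {y : ℝ} (hy : y ∈ Set.Icc (0 : ℝ) 1) : binP x y s ≤ 1 := by
  rcases lt_or_ge x s with h | h
  · simp [binP, Nat.choose_eq_zero_of_lt h]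
  · have hsum : ∑ t ∈ Finset.range (x + 1), binP x y t = 1 := by
      have := add_pow y (1 - y) x
      rw [add_sub_cancel, one_pow] at this
      rw [this]
      exact Finset.sum_congr rfl fun t _ => by rw [binP]; ring
    rw [← hsum]
    exact Finset.single_le_sum (f := fun t => binP x y t) (fun t _ => binP_nonneg x t hy)
      (by simpa using Nat.lt_succ_of_le h)

theorem mom_one_zero (Q : Measure (ℕ × ℝ)) : mom Q 1 0 = ∫ p, (p.1 : ℝ) ∂Q := by
  simp [mom]

theorem continuous_fst_cast : Continuous fun p : ℕ × ℝ => (p.1 : ℝ) :=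
  continuous_of_discreteTopology.comp continuous_fst

theorem integrable_fst_mul {Q : Measure (ℕ × ℝ)} (hQ : Integrable (fun p : ℕ × ℝ => (p.1 : ℝ)) Q)
    {h : ℕ × ℝ → ℝ} (hc : Continuous h) (hb : ∀ p, |h p| ≤ 1) :
    Integrable (fun p => (p.1 : ℝ) * h p) Q :=
  hQ.mul_bdd (c := 1) hc.aestronglyMeasurable (.of_forall hb)

theorem integrable_min_mul {Q : Measure (ℕ × ℝ)} (hQ : Integrable (fun p : ℕ × ℝ => (p.1 : ℝ)) Q)
    (K : ℕ) {h : ℕ × ℝ → ℝ} (hc : Continuous h) (hb : ∀ p, |h p| ≤ 1) :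
    Integrable (fun p => min (p.1 : ℝ) K * h p) Q := by
  refine (integrable_fst_mul hQ hc hb).mono
    ((continuous_fst_cast.min continuous_const).mul hc).aestronglyMeasurable
    (.of_forall fun p => ?_)
  rw [norm_mul, norm_mul]
  gcongr
  rw [Real.norm_of_nonneg (by positivity), Real.norm_of_nonneg (by positivity)]
  exact min_le_left _ _

theorem integrable_min {Q : Measure (ℕ × ℝ)} (hQ : Integrable (fun p : ℕ × ℝ => (p.1 : ℝ)) Q)
    (K : ℕ) : Integrable (fun p => min (p.1 : ℝ) K) Q := by
  simpa using integrable_min_mul hQ K (h := fun _ => 1) continuous_const (by simp)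

theorem tendsto_integral_min_mul {Pn : ℕ → ProbabilityMeasure (ℕ × ℝ)}
    {P : ProbabilityMeasure (ℕ × ℝ)} (hweak : Tendsto Pn atTop (𝓝 P)) (K : ℕ)
    {h : ℕ × ℝ → ℝ} (hc : Continuous h) (hb : ∀ p, |h p| ≤ 1) :
    Tendsto (fun n => ∫ p, min (p.1 : ℝ) K * h p ∂(Pn n : Measure (ℕ × ℝ))) atTop
      (𝓝 (∫ p, min (p.1 : ℝ) K * h p ∂(P : Measure (ℕ × ℝ)))) := by
  refine (ProbabilityMeasure.tendsto_iff_forall_integral_tendsto.1 hweak)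
    (BoundedContinuousFunction.ofNormedAddCommGroup (fun p : ℕ × ℝ => min (p.1 : ℝ) K * h p)
      ((continuous_fst_cast.min continuous_const).mul hc) K fun p => ?_)
  rw [norm_mul, Real.norm_of_nonneg (by positivity)]
  calc min (p.1 : ℝ) K * ‖h p‖ ≤ K * 1 :=
        mul_le_mul (min_le_right _ _) (hb p) (norm_nonneg _) (by positivity)
    _ = K := mul_one _

/-- The expected excess of the layer size over `K`. -/
def sizeTail (Q : Measure (ℕ × ℝ)) (K : ℕ) : ℝ := ∫ p, ((p.1 : ℝ) - min (p.1 : ℝ) K) ∂Q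

theorem tendsto_sizeTail {Q : Measure (ℕ × ℝ)} (hQ : Integrable (fun p : ℕ × ℝ => (p.1 : ℝ)) Q) :
    Tendsto (sizeTail Q) atTop (𝓝 0) := by
  have : Tendsto (fun K : ℕ => ∫ p, ((p.1 : ℝ) - min (p.1 : ℝ) K) ∂Q) atTop
      (𝓝 (∫ _, (0 : ℝ) ∂Q)) := by
    refine tendsto_integral_of_dominated_convergence (fun p => (p.1 : ℝ))
      (fun K => (continuous_fst_cast.sub
        (continuous_fst_cast.min continuous_const)).aestronglyMeasurable) hQ
      (fun K => .of_forall fun p => ?_) (.of_forall fun p => ?_)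
    · rw [Real.norm_of_nonneg (sub_nonneg.2 (min_le_left _ _))]
      exact sub_le_self _ (by positivity)
    · refine tendsto_const_nhds.congr' ?_
      filter_upwards [eventually_ge_atTop p.1] with K hK
      rw [min_eq_left (by exact_mod_cast hK), sub_self]
  rwa [integral_zero] at this

theorem eventually_sizeTail_lt {Pn : ℕ → ProbabilityMeasure (ℕ × ℝ)}
    {P : ProbabilityMeasure (ℕ × ℝ)} (hweak : Tendsto Pn atTop (𝓝 P))
    (hPn : ∀ n, Integrable (fun p : ℕ × ℝ => (p.1 : ℝ)) (Pn n : Measure (ℕ × ℝ)))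
    (hP : Integrable (fun p : ℕ × ℝ => (p.1 : ℝ)) (P : Measure (ℕ × ℝ)))
    (h10 : Tendsto (fun n => ∫ p, (p.1 : ℝ) ∂(Pn n : Measure (ℕ × ℝ))) atTop
      (𝓝 (∫ p, (p.1 : ℝ) ∂(P : Measure (ℕ × ℝ))))) {δ : ℝ} (hδ : 0 < δ) :
    ∃ K : ℕ, sizeTail (P : Measure (ℕ × ℝ)) K < δ ∧
      ∀ᶠ n in atTop, sizeTail (Pn n : Measure (ℕ × ℝ)) K < δ := by
  obtain ⟨K, hK⟩ := ((tendsto_sizeTail hP).eventually (gt_mem_nhds hδ)).exists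
  refine ⟨K, hK, ?_⟩
  have hmin := tendsto_integral_min_mul hweak K (h := fun _ => 1) continuous_const (by simp)
  simp only [mul_one] at hmin
  have : Tendsto (fun n => sizeTail (Pn n : Measure (ℕ × ℝ)) K) atTop
      (𝓝 (sizeTail (P : Measure (ℕ × ℝ)) K)) := by
    have h := h10.sub hmin
    simp only [sizeTail]
    rw [integral_sub hP (integrable_min hP K)]
    refine h.congr fun n => ?_
    rw [integral_sub (hPn n) (integrable_min (hPn n) K)]
  exact this.eventually (gt_mem_nhds hK)

theorem abs_integral_fst_mul_sub_le {Q : Measure (ℕ × ℝ)}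
    (hQ : Integrable (fun p : ℕ × ℝ => (p.1 : ℝ)) Q) (K : ℕ)
    {h : ℕ × ℝ → ℝ} (hc : Continuous h) (hb : ∀ p, |h p| ≤ 1) :
    |∫ p, (p.1 : ℝ) * h p ∂Q - ∫ p, min (p.1 : ℝ) K * h p ∂Q| ≤ sizeTail Q K := by
  rw [← integral_sub (integrable_fst_mul hQ hc hb) (integrable_min_mul hQ K hc hb)]
  refine (abs_integral_le_integral_abs).trans ?_
  refine integral_mono_of_nonneg (.of_forall fun p => abs_nonneg _)
    (hQ.sub (integrable_min hQ K)) (.of_forall fun p => ?_)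
  have h0 : 0 ≤ (p.1 : ℝ) - min (p.1 : ℝ) K := sub_nonneg.2 (min_le_left _ _)
  change |(p.1 : ℝ) * h p - min (p.1 : ℝ) K * h p| ≤ (p.1 : ℝ) - min (p.1 : ℝ) K
  rw [← sub_mul, abs_mul, abs_of_nonneg h0]
  exact mul_le_of_le_one_right h0 (hb p)

theorem tendsto_integral_fst_mul {Pn : ℕ → ProbabilityMeasure (ℕ × ℝ)}
    {P : ProbabilityMeasure (ℕ × ℝ)} (hweak : Tendsto Pn atTop (𝓝 P))
    (hPn : ∀ n, Integrable (fun p : ℕ × ℝ => (p.1 : ℝ)) (Pn n : Measure (ℕ × ℝ)))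
    (hP : Integrable (fun p : ℕ × ℝ => (p.1 : ℝ)) (P : Measure (ℕ × ℝ)))
    (h10 : Tendsto (fun n => ∫ p, (p.1 : ℝ) ∂(Pn n : Measure (ℕ × ℝ))) atTop
      (𝓝 (∫ p, (p.1 : ℝ) ∂(P : Measure (ℕ × ℝ)))))
    {h : ℕ × ℝ → ℝ} (hc : Continuous h) (hb : ∀ p, |h p| ≤ 1) :
    Tendsto (fun n => ∫ p, (p.1 : ℝ) * h p ∂(Pn n : Measure (ℕ × ℝ))) atTop
      (𝓝 (∫ p, (p.1 : ℝ) * h p ∂(P : Measure (ℕ × ℝ)))) := by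
  rw [Metric.tendsto_nhds]
  intro δ hδ
  obtain ⟨K, hK, hKn⟩ := eventually_sizeTail_lt hweak hPn hP h10 (by positivity : 0 < δ / 3)
  filter_upwards [hKn, (Metric.tendsto_nhds.1 (tendsto_integral_min_mul hweak K hc hb)) (δ / 3)
    (by positivity)] with n hn1 hn2
  have h1 := abs_le.1 ((abs_integral_fst_mul_sub_le (hPn n) K hc hb).trans hn1.le)
  have h2 := abs_lt.1 ((abs_integral_fst_mul_sub_le hP K hc hb).trans_lt hK)
  rw [Real.dist_eq] at hn2 ⊢
  have h3 := abs_lt.1 hn2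
  rw [abs_lt]
  constructor <;> linarith [h1.1, h1.2, h2.1, h2.2, h3.1, h3.2]

/-- The binomial mass function with the success probability projected to `[0,1]`. -/
def clampedBin (s : ℕ) (p : ℕ × ℝ) : ℝ :=
  binP (p.1 - 1) (Set.projIcc (0 : ℝ) 1 zero_le_one p.2) s

theorem continuous_clampedBin (s : ℕ) : Continuous (clampedBin s) := by
  refine continuous_prod_of_discrete_left.2 fun x => ?_
  simp only [clampedBin, binP]
  have : Continuous fun y => ((Set.projIcc (0 : ℝ) 1 zero_le_one y : Set.Icc (0 : ℝ) 1) : ℝ) :=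
    continuous_subtype_val.comp continuous_projIcc
  fun_prop

theorem abs_clampedBin_le (s : ℕ) (p : ℕ × ℝ) : |clampedBin s p| ≤ 1 := by
  unfold clampedBin
  rw [abs_of_nonneg (binP_nonneg _ _ (Subtype.prop _))]
  exact binP_le_one _ _ (Subtype.prop _)

theorem clampedBin_eq (s : ℕ) {p : ℕ × ℝ} (hp : p.2 ∈ Set.Icc (0 : ℝ) 1) :
    clampedBin s p = binP (p.1 - 1) p.2 s := by
  rw [clampedBin, Set.projIcc_of_mem zero_le_one hp]

theorem gInc_eq_clampedBin {Q : Measure (ℕ × ℝ)} (hQ : ∀ᵐ p ∂Q, p.2 ∈ Set.Icc (0 : ℝ) 1) (s : ℕ) :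
    gInc Q s = (∫ p, (p.1 : ℝ) * clampedBin s p ∂Q) / mom Q 1 0 := by
  rw [gInc]
  congr 1
  refine integral_congr_ae ?_
  filter_upwards [hQ] with p hp
  rw [clampedBin_eq s hp]

theorem gInc_nonneg {Q : Measure (ℕ × ℝ)} (hQ : ∀ᵐ p ∂Q, p.2 ∈ Set.Icc (0 : ℝ) 1) (s : ℕ) :
    0 ≤ gInc Q s := by
  rw [gInc_eq_clampedBin hQ, mom_one_zero]
  refine div_nonneg (integral_nonneg fun p => mul_nonneg (by positivity) ?_)
    (integral_nonneg fun p => by positivity)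
  exact binP_nonneg _ _ (Subtype.prop _)

theorem gInc_le_one {Q : Measure (ℕ × ℝ)} (hQ : ∀ᵐ p ∂Q, p.2 ∈ Set.Icc (0 : ℝ) 1)
    (hi : Integrable (fun p : ℕ × ℝ => (p.1 : ℝ)) Q) (s : ℕ) : gInc Q s ≤ 1 := by
  rw [gInc_eq_clampedBin hQ, mom_one_zero]
  refine div_le_one_of_le₀ (integral_mono
    (integrable_fst_mul hi (continuous_clampedBin s) (abs_clampedBin_le s)) hi fun p => ?_)
    (integral_nonneg fun p => by positivity)
  exact mul_le_of_le_one_right (by positivity) (binP_le_one _ _ (Subtype.prop _))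

theorem tendsto_gInc {Pn : ℕ → ProbabilityMeasure (ℕ × ℝ)}
    {P : ProbabilityMeasure (ℕ × ℝ)} (hweak : Tendsto Pn atTop (𝓝 P))
    (hyn : ∀ n, ∀ᵐ p ∂(Pn n : Measure (ℕ × ℝ)), p.2 ∈ Set.Icc (0 : ℝ) 1)
    (hy : ∀ᵐ p ∂(P : Measure (ℕ × ℝ)), p.2 ∈ Set.Icc (0 : ℝ) 1)
    (hPn : ∀ n, Integrable (fun p : ℕ × ℝ => (p.1 : ℝ)) (Pn n : Measure (ℕ × ℝ)))
    (hP : Integrable (fun p : ℕ × ℝ => (p.1 : ℝ)) (P : Measure (ℕ × ℝ)))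
    (hpos : 0 < mom (P : Measure (ℕ × ℝ)) 1 0)
    (h10 : Tendsto (fun n => mom (Pn n : Measure (ℕ × ℝ)) 1 0) atTop
      (𝓝 (mom (P : Measure (ℕ × ℝ)) 1 0))) (s : ℕ) :
    Tendsto (fun n => gInc (Pn n : Measure (ℕ × ℝ)) s) atTop
      (𝓝 (gInc (P : Measure (ℕ × ℝ)) s)) := by
  simp_rw [fun n => gInc_eq_clampedBin (hyn n) s, gInc_eq_clampedBin hy s]
  refine Tendsto.div (tendsto_integral_fst_mul hweak hPn hP ?_ (continuous_clampedBin s)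
    (abs_clampedBin_le s)) h10 hpos.ne'
  simpa only [mom_one_zero] using h10

instance (n : ℕ) : DiscreteMeasurableSpace (Finset (Fin n)) := ⟨fun _ => trivial⟩

theorem measurable_bern_apply (b : Bool) : Measurable fun y : ℝ => bern y {b} := by
  simp only [bern, PMF.toMeasure_apply_singleton _ _ (MeasurableSet.singleton b),
    PMF.bernoulli_apply]
  refine Measurable.coe_nnreal_ennreal ?_
  cases b
  · exact measurable_const.sub (measurable_real_toNNReal.min measurable_const)
  · exact measurable_real_toNNReal.min measurable_const

theorem bern_real_true {y : ℝ} (hy : y ∈ Set.Icc (0 : ℝ) 1) : (bern y).real {true} = y := by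
  have : min y.toNNReal 1 = y.toNNReal := min_eq_left (Real.toNNReal_le_one.2 hy.2)
  simp [bern, Measure.real, PMF.bernoulli_apply, this, hy.1]

theorem bern_real_false {y : ℝ} (hy : y ∈ Set.Icc (0 : ℝ) 1) : (bern y).real {false} = 1 - y := by
  have h : ({false} : Set Bool) = {true}ᶜ := by ext b; cases b <;> simp
  rw [h, probReal_compl_eq_one_sub (MeasurableSet.singleton _), bern_real_true hy]

theorem measurable_edgeFactor_apply (n : ℕ) (V : Finset (Fin n)) (e : Sym2 (Fin n)) (b : Bool) :
    Measurable fun y : ℝ => edgeFactor n V y e {b} := by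
  unfold edgeFactor
  split_ifs
  · exact measurable_bern_apply b
  · exact measurable_const

/-- The conditional law of a layer given its type. -/
def layerKernel (n : ℕ) (xy : ℕ × ℝ) : Measure (Layer n) :=
  (vertexMeasure n xy.1).bind fun V => (edgeMeasure n V xy.2).map fun f => (xy, V, f)

theorem measurable_layer_mk (n : ℕ) (xy : ℕ × ℝ) (V : Finset (Fin n)) :
    Measurable fun f : Sym2 (Fin n) → Bool => ((xy, V, f) : Layer n) :=
  measurable_const.prodMk (measurable_const.prodMk measurable_id)

theorem layerKernel_apply (n : ℕ) (xy : ℕ × ℝ) {A : Set (Layer n)} (hA : MeasurableSet A) :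
    layerKernel n xy A = ∑ V, edgeMeasure n V xy.2 {f | (xy, V, f) ∈ A} *
      vertexMeasure n xy.1 {V} := by
  rw [layerKernel, Measure.bind_apply hA (Measurable.of_discrete).aemeasurable, lintegral_fintype]
  refine Finset.sum_congr rfl fun V _ => ?_
  rw [Measure.map_apply (measurable_layer_mk n xy V) hA]
  rfl

theorem edgeMeasure_apply (n : ℕ) (V : Finset (Fin n)) (y : ℝ) (B : Set (Sym2 (Fin n) → Bool)) :
    edgeMeasure n V y B =
      ∑ f, B.indicator 1 f * ∏ e, edgeFactor n V y e {f e} := by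
  rw [← lintegral_indicator_one (MeasurableSet.of_discrete : MeasurableSet B), lintegral_fintype]
  simp only [edgeMeasure, Measure.pi_singleton]

instance (n : ℕ) (xy : ℕ × ℝ) : IsProbabilityMeasure (layerKernel n xy) := by
  refine ⟨?_⟩
  rw [layerKernel_apply n xy MeasurableSet.univ]
  simp [sum_measure_singleton]

theorem measurable_layerKernel (n : ℕ) : Measurable (layerKernel n) := by
  refine Measure.measurable_of_measurable_coe _ fun A hA => ?_
  simp_rw [layerKernel_apply n _ hA, edgeMeasure_apply]
  refine Finset.measurable_fun_sum _ fun V _ => Measurable.mul ?_ ?_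
  · refine Finset.measurable_fun_sum _ fun f _ => Measurable.mul ?_ ?_
    · have hm : Measurable fun xy : ℕ × ℝ => ((xy, V, f) : Layer n) := by fun_prop
      exact (measurable_one.indicator hA).comp hm
    · exact Finset.measurable_fun_prod _ fun e _ =>
        (measurable_edgeFactor_apply n V e (f e)).comp measurable_snd
  · exact (measurable_from_nat (f := fun x => vertexMeasure n x {V})).comp measurable_fst

theorem layerMeasure_eq_bind (n : ℕ) (Q : Measure (ℕ × ℝ)) :
    layerMeasure n Q = Q.bind (layerKernel n) := rfl

instance (n : ℕ) (Q : Measure (ℕ × ℝ)) [IsProbabilityMeasure Q] :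
    IsProbabilityMeasure (layerMeasure n Q) := by
  refine ⟨?_⟩
  rw [layerMeasure_eq_bind, Measure.bind_apply MeasurableSet.univ
    (measurable_layerKernel n).aemeasurable]
  simp

theorem layerMeasure_real (n : ℕ) (Q : Measure (ℕ × ℝ)) {A : Set (Layer n)}
    (hA : MeasurableSet A) :
    (layerMeasure n Q).real A = ∫ xy, (layerKernel n xy).real A ∂Q := by
  rw [Measure.real, layerMeasure_eq_bind, Measure.bind_apply hA
    (measurable_layerKernel n).aemeasurable]
  refine (integral_toReal ?_ (.of_forall fun xy => measure_lt_top _ _)).symm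
  exact ((Measure.measurable_coe hA).comp (measurable_layerKernel n)).aemeasurable

theorem measurableSet_layer (n : ℕ) (B : Set (ℕ × Finset (Fin n) × (Sym2 (Fin n) → Bool))) :
    MeasurableSet {L : Layer n | (L.1.1, L.2) ∈ B} := by
  have hm : Measurable fun L : Layer n => (L.1.1, L.2) := by fun_prop
  exact hm (MeasurableSet.of_discrete : MeasurableSet B)

theorem layerKernel_real (n : ℕ) (xy : ℕ × ℝ) {A : Set (Layer n)} (hA : MeasurableSet A) :
    (layerKernel n xy).real A = ∑ V, (edgeMeasure n V xy.2).real {f | (xy, V, f) ∈ A} *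
      (vertexMeasure n xy.1).real {V} := by
  rw [Measure.real, layerKernel_apply n xy hA, ENNReal.toReal_sum]
  · simp [Measure.real]
  · exact fun V _ => ENNReal.mul_ne_top (measure_ne_top _ _) (measure_ne_top _ _)

theorem layerKernel_real_type_vertex (n : ℕ) (xy : ℕ × ℝ) (X : Set ℕ) (B : Set (Finset (Fin n))) :
    (layerKernel n xy).real {L | L.1.1 ∈ X ∧ L.2.1 ∈ B} =
      if xy.1 ∈ X then (vertexMeasure n xy.1).real B else 0 := by
  have hA : MeasurableSet {L : Layer n | L.1.1 ∈ X ∧ L.2.1 ∈ B} :=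
    measurableSet_layer n {q | q.1 ∈ X ∧ q.2.1 ∈ B}
  have hB : (vertexMeasure n xy.1).real B =
      ∑ V, if V ∈ B then (vertexMeasure n xy.1).real {V} else 0 := by
    rw [← Finset.sum_filter, sum_measureReal_singleton]
    simp
  rw [layerKernel_real n xy hA]
  split_ifs with h
  · rw [hB]
    refine Finset.sum_congr rfl fun V _ => ?_
    by_cases hV : V ∈ B <;> simp [h, hV]
  · simp [h]

theorem vertexMeasure_real {n x : ℕ} (hx : x ≤ n) (B : Set (Finset (Fin n))) :
    (vertexMeasure n x).real B =
      ((Finset.powersetCard x (Finset.univ : Finset (Fin n))).filter (· ∈ B)).card /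
        (n.choose x : ℝ) := by
  have h : (Finset.powersetCard x (Finset.univ : Finset (Fin n))).Nonempty :=
    Finset.powersetCard_nonempty.2 (by simpa using hx)
  rw [vertexMeasure, dif_pos h, Measure.real,
    PMF.toMeasure_uniformOfFinset_apply h _ MeasurableSet.of_discrete]
  simp [ENNReal.toReal_div]

theorem vertexMeasure_real_singleton {n x : ℕ} (hx : x ≤ n) (V : Finset (Fin n)) :
    (vertexMeasure n x).real {V} = if V.card = x then 1 / (n.choose x : ℝ) else 0 := by
  rw [vertexMeasure_real hx]
  simp only [Set.mem_singleton_iff, Finset.filter_eq', Finset.mem_powersetCard_univ]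
  split_ifs <;> simp

theorem card_powersetCard_superset {n x : ℕ} (S : Finset (Fin n)) (hS : S.card ≤ x) :
    ((Finset.powersetCard x (Finset.univ : Finset (Fin n))).filter (S ⊆ ·)).card =
      (n - S.card).choose (x - S.card) := by
  have h := Finset.card_filter_powersetCard_subset S Finset.univ x (Finset.subset_univ S) hS
  rw [Finset.card_univ, Fintype.card_fin] at h
  convert h

theorem vertexMeasure_real_mem {n x : ℕ} (hx : x ≤ n) (v : Fin n) :
    (vertexMeasure n x).real {V | v ∈ V} = x / n := by
  rw [vertexMeasure_real hx]
  have hn : 0 < n := v.pos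
  rcases Nat.eq_zero_or_pos x with rfl | hx0
  · simp
  · have h := card_powersetCard_superset (x := x) {v} (by rw [Finset.card_singleton]; exact hx0)
    simp only [Finset.singleton_subset_iff, Finset.card_singleton] at h
    simp only [Set.mem_ofPred_eq]
    rw [h, div_eq_div_iff]
    · obtain ⟨n, rfl⟩ : ∃ k, n = k + 1 := ⟨n - 1, by omega⟩
      obtain ⟨x, rfl⟩ : ∃ k, x = k + 1 := ⟨x - 1, by omega⟩
      have := Nat.add_one_mul_choose_eq n x
      simp only [Nat.add_sub_cancel]
      rw [mul_comm, mul_comm ((x + 1 : ℕ) : ℝ)]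
      exact_mod_cast this
    · exact_mod_cast (Nat.choose_pos hx).ne'
    · exact_mod_cast hn.ne'

theorem vertexMeasure_real_pair_le {n x : ℕ} (hx : x ≤ n) {v w : Fin n} (hvw : v ≠ w) :
    (vertexMeasure n x).real {V | v ∈ V ∧ w ∈ V} ≤ (x : ℝ) ^ 2 / (n * (n - 1)) := by
  have hcard : ({v, w} : Finset (Fin n)).card = 2 := Finset.card_pair hvw
  have hn : 2 ≤ n := by
    rw [← hcard]; exact (Finset.card_le_univ _).trans_eq (Fintype.card_fin n)
  have hn1 : (0 : ℝ) < n - 1 := by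
    have : (2 : ℝ) ≤ n := by exact_mod_cast hn
    linarith
  have hmem : ∀ V : Finset (Fin n), V ∈ {V : Finset (Fin n) | v ∈ V ∧ w ∈ V} ↔ {v, w} ⊆ V := by
    intro V; simp [Finset.insert_subset_iff]
  rw [vertexMeasure_real hx]
  simp only [hmem]
  rcases lt_or_ge x 2 with hx2 | hx2
  · have : (Finset.powersetCard x (Finset.univ : Finset (Fin n))).filter ({v, w} ⊆ ·) = ∅ := by
      ext V
      simp only [Finset.mem_filter, Finset.mem_powersetCard, Finset.notMem_empty, iff_false]
      rintro ⟨⟨-, h1⟩, h2⟩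
      have := Finset.card_le_card h2
      omega
    rw [this]
    simp only [Finset.card_empty, Nat.cast_zero, zero_div]
    positivity
  · rw [card_powersetCard_superset _ (hcard.trans_le hx2), hcard]
    obtain ⟨n, rfl⟩ : ∃ k, n = k + 2 := ⟨n - 2, by omega⟩
    obtain ⟨x, rfl⟩ : ∃ k, x = k + 2 := ⟨x - 2, by omega⟩
    have h1 := Nat.add_one_mul_choose_eq n x
    have h2 := Nat.add_one_mul_choose_eq (n + 1) (x + 1)
    have hc : (0 : ℝ) < ((n + 2).choose (x + 2) : ℝ) := by exact_mod_cast Nat.choose_pos hx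
    have key : ((n : ℝ) + 2) * (n + 1) * (n.choose x : ℝ) =
        ((n + 2).choose (x + 2) : ℝ) * ((x + 2) * (x + 1)) := by
      have h1' : ((n : ℝ) + 1) * (n.choose x : ℝ) = ((n + 1).choose (x + 1) : ℝ) * (x + 1) := by
        exact_mod_cast h1
      have h2' : ((n : ℝ) + 2) * ((n + 1).choose (x + 1) : ℝ) =
          ((n + 2).choose (x + 2) : ℝ) * (x + 2) := by
        exact_mod_cast h2
      calc _ = ((n : ℝ) + 2) * (((n : ℝ) + 1) * (n.choose x : ℝ)) := by ring
        _ = _ := by rw [h1', ← mul_assoc, h2']; ring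
    rw [div_le_div_iff₀ hc (mul_pos (by positivity) hn1)]
    simp only [Nat.add_sub_cancel]
    push_cast
    have e : (n.choose x : ℝ) * (((n : ℝ) + 2) * (n + 2 - 1)) =
        ((n + 2).choose (x + 2) : ℝ) * ((x + 2) * (x + 1)) := by rw [← key]; ring
    rw [e, mul_comm]
    gcongr
    nlinarith

theorem pi_real_card_filter_eq {ι : Type*} [Fintype ι] (κ : ι → Measure Bool)
    [∀ i, IsProbabilityMeasure (κ i)] (S : Finset ι) {y : ℝ} (hy : y ∈ Set.Icc (0 : ℝ) 1)
    (hS : ∀ i ∈ S, κ i = bern y) (s : ℕ) :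
    (Measure.pi κ).real {f | (S.filter fun i => f i = true).card = s} = binP S.card y s := by
  have hset : {f : ι → Bool | (S.filter fun i => f i = true).card = s} =
      ⋃ T ∈ S.powersetCard s, {f | S.filter (fun i => f i = true) = T} := by
    ext f
    simp [Finset.filter_subset]
  have hpoint : ∀ T ∈ S.powersetCard s,
      (Measure.pi κ).real {f | S.filter (fun i => f i = true) = T} =
        y ^ s * (1 - y) ^ (S.card - s) := by
    intro T hT
    obtain ⟨hTS, hTs⟩ := Finset.mem_powersetCard.1 hT
    have hbox : {f : ι → Bool | S.filter (fun i => f i = true) = T} =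
        Set.univ.pi fun i => if i ∈ S then (if i ∈ T then {true} else {false}) else Set.univ := by
      ext f
      simp only [Set.mem_ofPred_eq, Set.mem_pi, Set.mem_univ, true_implies, Finset.ext_iff,
        Finset.mem_filter]
      refine forall_congr' fun i => ?_
      by_cases hi : i ∈ S
      · by_cases hiT : i ∈ T <;> simp [hi, hiT]
      · have hiT : i ∉ T := fun h => hi (hTS h)
        simp [hi, hiT]
    rw [hbox, Measure.real, Measure.pi_pi, ENNReal.toReal_prod]
    have hfac : ∀ i, (κ i (if i ∈ S then (if i ∈ T then {true} else {false}) else Set.univ)).toReal =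
        if i ∈ S then (if i ∈ T then y else 1 - y) else 1 := by
      intro i
      split_ifs with hi hiT
      · rw [hS i hi]; exact bern_real_true hy
      · rw [hS i hi]; exact bern_real_false hy
      · rw [measure_univ, ENNReal.toReal_one]
    simp_rw [hfac]
    rw [Finset.prod_ite_mem, Finset.univ_inter, Finset.prod_ite, Finset.prod_const,
      Finset.prod_const, Finset.filter_mem_eq_inter, Finset.inter_eq_right.2 hTS, hTs,
      Finset.filter_notMem_eq_sdiff, Finset.card_sdiff_of_subset hTS, hTs]
  rw [hset, measureReal_biUnion_finset _ (fun T _ => MeasurableSet.of_discrete),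
    Finset.sum_congr rfl hpoint, Finset.sum_const, Finset.card_powersetCard, nsmul_eq_mul, binP,
    mul_assoc]
  intro T _ T' _ hTT'
  exact Set.disjoint_left.2 fun f hf hf' => hTT' (hf.symm.trans hf')

/-- The non-loop pairs inside `V` that contain the node `o`. -/
def starPairs {n : ℕ} (o : Fin n) (V : Finset (Fin n)) : Finset (Sym2 (Fin n)) :=
  Finset.univ.filter fun e => (¬ e.IsDiag ∧ ∀ v ∈ e, v ∈ V) ∧ o ∈ e

theorem card_starPairs {n : ℕ} (o : Fin n) (V : Finset (Fin n)) :
    (starPairs o V).card = if o ∈ V then V.card - 1 else 0 := by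
  split_ifs with ho
  · have h : starPairs o V = (V.erase o).image fun v => s(o, v) := by
      ext e
      simp only [starPairs, Finset.mem_filter, Finset.mem_univ, true_and, Finset.mem_image,
        Finset.mem_erase]
      constructor
      · rintro ⟨⟨hd, hV⟩, hoe⟩
        obtain ⟨v, rfl⟩ := Sym2.mem_iff_exists.1 hoe
        exact ⟨v, ⟨fun h => hd (by simp [h]), hV v (by simp)⟩, rfl⟩
      · rintro ⟨v, ⟨hne, hv⟩, rfl⟩
        refine ⟨⟨by simpa using hne.symm, fun w hw => ?_⟩, by simp⟩
        rcases Sym2.mem_iff.1 hw with rfl | rfl <;> assumption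
    rw [h, Finset.card_image_of_injective, Finset.card_erase_of_mem ho]
    intro v w hvw
    exact Sym2.congr_right.1 hvw
  · rw [Finset.card_eq_zero, Finset.eq_empty_iff_forall_notMem]
    intro e he
    simp only [starPairs, Finset.mem_filter, Finset.mem_univ, true_and] at he
    exact ho (he.1.2 o he.2)

/-- The edges of a layer that contain the node with label `i`. -/
def layerStar {n : ℕ} (i : ℕ) (L : Layer n) : Finset (Sym2 (Fin n)) :=
  (layerEdges L).filter fun e => ∃ v : Fin n, v ∈ e ∧ (v : ℕ) = i

theorem layerStar_eq {n : ℕ} (o : Fin n) (L : Layer n) :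
    layerStar o L = (starPairs o L.2.1).filter fun e => L.2.2 e = true := by
  ext e
  have : (∃ v : Fin n, v ∈ e ∧ (v : ℕ) = o) ↔ o ∈ e :=
    ⟨fun ⟨v, hv, h⟩ => Fin.ext h ▸ hv, fun h => ⟨o, h, rfl⟩⟩
  simp only [layerStar, layerEdges, starPairs, Finset.mem_filter, Finset.mem_univ, true_and, this]
  tauto

theorem edgeMeasure_real_layerStar {n : ℕ} (o : Fin n) (xy : ℕ × ℝ)
    (hy : xy.2 ∈ Set.Icc (0 : ℝ) 1) (V : Finset (Fin n)) (s : ℕ) :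
    (edgeMeasure n V xy.2).real {f | (layerStar o ((xy, V, f) : Layer n)).card = s} =
      binP (if o ∈ V then V.card - 1 else 0) xy.2 s := by
  simp only [layerStar_eq]
  rw [edgeMeasure, pi_real_card_filter_eq _ _ hy (fun e he => ?_), card_starPairs]
  simp only [starPairs, Finset.mem_filter, Finset.mem_univ, true_and] at he
  rw [edgeFactor, if_pos he.1]

theorem layerKernel_real_layerStar {n : ℕ} (o : Fin n) {xy : ℕ × ℝ} (hx : xy.1 ≤ n)
    (hy : xy.2 ∈ Set.Icc (0 : ℝ) 1) (s : ℕ) :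
    (layerKernel n xy).real {L | (layerStar o L).card = s} =
      (1 - (xy.1 : ℝ) / n) * (if s = 0 then 1 else 0) + xy.1 / n * binP (xy.1 - 1) xy.2 s := by
  have hA : MeasurableSet {L : Layer n | (layerStar o L).card = s} := by
    simp only [layerStar_eq]
    exact measurableSet_layer n
      {q | ((starPairs o q.2.1).filter fun e => q.2.2 e = true).card = s}
  have hbin0 : binP 0 xy.2 s = if s = 0 then 1 else 0 := by
    rcases s with _ | s <;> simp [binP]
  have hterm : ∀ V, (edgeMeasure n V xy.2).real {f | (xy, V, f) ∈ {L : Layer n |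
      (layerStar o L).card = s}} * (vertexMeasure n xy.1).real {V} =
      binP 0 xy.2 s * (vertexMeasure n xy.1).real {V} +
      (binP (xy.1 - 1) xy.2 s - binP 0 xy.2 s) *
        (if V ∈ {V : Finset (Fin n) | o ∈ V} then (vertexMeasure n xy.1).real {V} else 0) := by
    intro V
    have := edgeMeasure_real_layerStar o xy hy V s
    simp only [Set.mem_ofPred_eq] at this ⊢
    rw [this, vertexMeasure_real_singleton hx]
    by_cases hV : V.card = xy.1
    · split_ifs
      · rw [hV]; ring
      · ring
    · simp [hV]
  rw [layerKernel_real n xy hA, Finset.sum_congr rfl fun V _ => hterm V, Finset.sum_add_distrib,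
    ← Finset.mul_sum, ← Finset.mul_sum, ← Finset.sum_filter, sum_measureReal_singleton,
    sum_measureReal_singleton, hbin0]
  have h1 : (vertexMeasure n xy.1).real ((Finset.univ : Finset (Finset (Fin n))) : Set _) = 1 := by
    simp
  have h2 : (vertexMeasure n xy.1).real ((Finset.univ.filter
      (· ∈ {V : Finset (Fin n) | o ∈ V}) : Finset (Finset (Fin n))) : Set _) = xy.1 / n := by
    rw [← vertexMeasure_real_mem hx o]
    congr 1
    ext V
    simp
  rw [h1, h2]
  ring

theorem measurable_card_layerStar {n : ℕ} (o : Fin n) :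
    Measurable fun L : Layer n => (layerStar o L).card := by
  simp only [layerStar_eq]
  have hm : Measurable fun L : Layer n => L.2 := measurable_snd
  exact (Measurable.of_discrete (f := fun q : Finset (Fin n) × (Sym2 (Fin n) → Bool) =>
    ((starPairs o q.1).filter fun e => q.2 e = true).card)).comp hm

theorem integrable_fst_of_le {Q : Measure (ℕ × ℝ)} [IsProbabilityMeasure Q] {n : ℕ}
    (hQ : ∀ᵐ p ∂Q, p.1 ≤ n) : Integrable (fun p : ℕ × ℝ => (p.1 : ℝ)) Q := by
  have hm : Measurable fun p : ℕ × ℝ => (p.1 : ℝ) := by fun_prop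
  refine .of_bound hm.aestronglyMeasurable n ?_
  filter_upwards [hQ] with p hp
  simpa using hp

theorem layerMeasure_real_layerStar {n : ℕ} (o : Fin n) {Q : Measure (ℕ × ℝ)}
    [IsProbabilityMeasure Q] (hQ : ∀ᵐ p ∂Q, p.1 ≤ n ∧ p.2 ∈ Set.Icc (0 : ℝ) 1)
    (hpos : 0 < mom Q 1 0) (s : ℕ) :
    (layerMeasure n Q).real {L | (layerStar o L).card = s} =
      (1 - mom Q 1 0 / n) * (if s = 0 then 1 else 0) + mom Q 1 0 / n * gInc Q s := by
  have hi := integrable_fst_of_le (hQ.mono fun p hp => hp.1)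
  have hib := integrable_fst_mul hi (continuous_clampedBin s) (abs_clampedBin_le s)
  have hA : MeasurableSet {L : Layer n | (layerStar o L).card = s} :=
    measurable_card_layerStar o (MeasurableSet.singleton s)
  rw [mom_one_zero] at hpos
  rw [layerMeasure_real n Q hA, gInc_eq_clampedBin (hQ.mono fun p hp => hp.2), mom_one_zero]
  have : ∀ᵐ p ∂Q, (layerKernel n p).real {L | (layerStar o L).card = s} =
      (if s = 0 then 1 else 0) - (p.1 : ℝ) * ((if s = 0 then 1 else 0) / n) +
        (p.1 : ℝ) * clampedBin s p * (1 / n) := by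
    filter_upwards [hQ] with p hp
    rw [layerKernel_real_layerStar o hp.1 hp.2, clampedBin_eq s hp.2]
    ring
  refine (integral_congr_ae this).trans ?_
  have hsub : Integrable (fun p : ℕ × ℝ => (if s = 0 then (1 : ℝ) else 0) -
      (p.1 : ℝ) * ((if s = 0 then 1 else 0) / n)) Q := (integrable_const _).sub (hi.mul_const _)
  rw [integral_add hsub (hib.mul_const _),
    integral_sub (integrable_const _) (hi.mul_const _), integral_mul_const, integral_mul_const]
  have hne := hpos.ne'
  simp only [integral_const, probReal_univ, one_smul]
  field_simp

theorem measurableSet_layer_type_vertex (n : ℕ) (X : Set ℕ) (B : Set (Finset (Fin n))) :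
    MeasurableSet {L : Layer n | L.1.1 ∈ X ∧ L.2.1 ∈ B} :=
  measurableSet_layer n {q | q.1 ∈ X ∧ q.2.1 ∈ B}

theorem layerMeasure_real_mem {n : ℕ} (o : Fin n) {Q : Measure (ℕ × ℝ)} [IsProbabilityMeasure Q]
    (hQ : ∀ᵐ p ∂Q, p.1 ≤ n) :
    (layerMeasure n Q).real {L | o ∈ L.2.1} = (∫ p, (p.1 : ℝ) ∂Q) / n := by
  have h : {L : Layer n | o ∈ L.2.1} =
      {L | L.1.1 ∈ Set.univ ∧ L.2.1 ∈ {V : Finset (Fin n) | o ∈ V}} := by ext; simp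
  rw [h, layerMeasure_real n Q (measurableSet_layer_type_vertex n _ _), ← integral_div]
  refine integral_congr_ae ?_
  filter_upwards [hQ] with p hp
  refine (layerKernel_real_type_vertex n p Set.univ {V | o ∈ V}).trans ?_
  rw [if_pos (Set.mem_univ _), vertexMeasure_real_mem hp]

theorem layerMeasure_real_mem_large_le {n : ℕ} (o : Fin n) {Q : Measure (ℕ × ℝ)}
    [IsProbabilityMeasure Q] (hQ : ∀ᵐ p ∂Q, p.1 ≤ n) (K : ℕ) :
    (layerMeasure n Q).real {L | 2 * K < L.1.1 ∧ o ∈ L.2.1} ≤ 2 * sizeTail Q K / n := by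
  have hi := integrable_fst_of_le hQ
  have hmeas := measurableSet_layer_type_vertex n {x | 2 * K < x} {V : Finset (Fin n) | o ∈ V}
  refine (layerMeasure_real n Q hmeas).trans_le ?_
  rw [sizeTail, ← integral_const_mul, ← integral_div]
  refine integral_mono_of_nonneg (.of_forall fun p => measureReal_nonneg)
    (((hi.sub (integrable_min hi K)).const_mul 2).div_const _) ?_
  filter_upwards [hQ] with p hp
  refine (layerKernel_real_type_vertex n p {x | 2 * K < x} {V | o ∈ V}).trans_le ?_
  rw [vertexMeasure_real_mem hp]
  split_ifs with h
  · have h' : 2 * (K : ℝ) < p.1 := by exact_mod_cast (h : 2 * K < p.1)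
    gcongr
    rw [min_eq_right (by have : (0 : ℝ) ≤ K := Nat.cast_nonneg K; linarith)]
    linarith
  · have : 0 ≤ (p.1 : ℝ) - min (p.1 : ℝ) K := sub_nonneg.2 (min_le_left _ _)
    positivity

theorem layerMeasure_real_pair_small_le {n : ℕ} {o v : Fin n} (hov : o ≠ v) {Q : Measure (ℕ × ℝ)}
    [IsProbabilityMeasure Q] (hQ : ∀ᵐ p ∂Q, p.1 ≤ n) (M : ℕ) :
    (layerMeasure n Q).real {L | L.1.1 ≤ M ∧ o ∈ L.2.1 ∧ v ∈ L.2.1} ≤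
      (M : ℝ) ^ 2 / (n * (n - 1)) := by
  have hn : (1 : ℝ) ≤ n := by exact_mod_cast o.pos
  have hn1 : (0 : ℝ) ≤ n - 1 := by linarith
  have hmeas := measurableSet_layer_type_vertex n {x | x ≤ M}
    {V : Finset (Fin n) | o ∈ V ∧ v ∈ V}
  refine (layerMeasure_real n Q hmeas).trans_le ?_
  have hc : ∫ _, (M : ℝ) ^ 2 / (n * (n - 1)) ∂Q = (M : ℝ) ^ 2 / (n * (n - 1)) := by simp
  rw [← hc]
  refine integral_mono_of_nonneg (.of_forall fun p => measureReal_nonneg)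
    (integrable_const _) ?_
  filter_upwards [hQ] with p hp
  refine (layerKernel_real_type_vertex n p {x | x ≤ M} {V | o ∈ V ∧ v ∈ V}).trans_le ?_
  split_ifs with h
  · refine (vertexMeasure_real_pair_le hp hov).trans ?_
    have h' : p.1 ≤ M := h
    gcongr
  · positivity

theorem pi_real_sum_eq_convPow {α : Type*} [MeasurableSpace α] (ν : Measure α)
    [IsProbabilityMeasure ν] {D : α → ℕ} (hD : Measurable D) (m s : ℕ) :
    (Measure.pi fun _ : Fin m => ν).real {ω | ∑ k, D (ω k) = s} =
      convPow (fun t => ν.real {a | D a = t}) m s := by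
  induction m generalizing s with
  | zero =>
    by_cases hs : s = 0
    · simp [convPow, hs]
    · simp [convPow, hs, Ne.symm hs]
  | succ m ih =>
    have hmp := measurePreserving_piFinSuccAbove (fun _ : Fin (m + 1) => ν) 0
    have hmeasD : ∀ t, MeasurableSet {a | D a = t} := fun t => hD (MeasurableSet.singleton t)
    have hmeasS : ∀ t, MeasurableSet {ω : Fin m → α | ∑ k, D (ω k) = t} := fun t =>
      (Finset.measurable_fun_sum _ fun k _ => hD.comp (measurable_pi_apply k) :
        Measurable fun ω : Fin m → α => ∑ k, D (ω k)) (MeasurableSet.singleton t)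
    have hset : {ω : Fin (m + 1) → α | ∑ k, D (ω k) = s} =
        MeasurableEquiv.piFinSuccAbove (fun _ => α) 0 ⁻¹'
          ⋃ i ∈ Finset.range (s + 1), {a | D a = i} ×ˢ {ω | ∑ k, D (ω k) = s - i} := by
      ext ω
      simp only [Set.mem_ofPred_eq, Set.mem_preimage, Set.mem_iUnion, Set.mem_prod,
        Fin.sum_univ_succ, Finset.mem_range, exists_prop]
      change _ ↔ ∃ i, i < s + 1 ∧ D (ω 0) = i ∧ ∑ k : Fin m, D (ω k.succ) = s - i
      constructor
      · intro h; exact ⟨_, by omega, rfl, by omega⟩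
      · rintro ⟨i, hi, h1, h2⟩; omega
    have hms : MeasurableSet (⋃ i ∈ Finset.range (s + 1),
        {a | D a = i} ×ˢ {ω : Fin m → α | ∑ k, D (ω k) = s - i}) :=
      Finset.measurableSet_biUnion _ fun i _ => (hmeasD i).prod (hmeasS _)
    rw [hset, Measure.real, hmp.measure_preimage hms.nullMeasurableSet, ← Measure.real,
      measureReal_biUnion_finset]
    · simp only [convPow, conv]
      refine Finset.sum_congr rfl fun i _ => ?_
      rw [measureReal_prod_prod, ← ih]
    · intro i _ j _ hij
      exact Set.disjoint_left.2 fun x hx hx' => hij (hx.1.symm.trans hx'.1)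
    · exact fun i _ => (hmeasD i).prod (hmeasS _)

theorem pi_real_pair {α ι : Type*} [MeasurableSpace α] [Fintype ι] (ν : Measure α)
    [IsProbabilityMeasure ν] {k l : ι} (hkl : k ≠ l) (A B : Set α) :
    (Measure.pi fun _ : ι => ν).real {ω | ω k ∈ A ∧ ω l ∈ B} = ν.real A * ν.real B := by
  have hset : {ω : ι → α | ω k ∈ A ∧ ω l ∈ B} =
      Set.univ.pi fun i => if i = k then A else if i = l then B else Set.univ := by
    ext ω
    simp only [Set.mem_ofPred_eq, Set.mem_pi, Set.mem_univ, true_implies]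
    constructor
    · rintro ⟨hA, hB⟩ i
      split_ifs with h1 h2
      · exact h1 ▸ hA
      · exact h2 ▸ hB
      · trivial
    · intro h
      exact ⟨by simpa using h k, by simpa [hkl.symm] using h l⟩
  rw [hset, Measure.real, Measure.pi_pi, Finset.prod_eq_mul k l hkl]
  · simp [hkl.symm, Measure.real]
  · rintro i - ⟨h1, h2⟩
    simp [h1, h2]
  · simp
  · simp

/-- The event that two distinct layers share an edge at the node with label `i`. -/
def overlapEvent (n m i : ℕ) : Set (Fin m → Layer n) :=
  {ω | ∃ k l, k ≠ l ∧ ¬ Disjoint (layerStar i (ω k)) (layerStar i (ω l))}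

theorem deg_eq_sum_of_notMem_overlapEvent {n m i : ℕ} {ω : Fin m → Layer n}
    (h : ω ∉ overlapEvent n m i) : deg ω i = ∑ k, (layerStar i (ω k)).card := by
  rw [deg, graphEdges, Finset.filter_biUnion, Finset.card_biUnion]
  · rfl
  · intro k _ l _ hkl
    by_contra hd
    exact h ⟨k, l, hkl, hd⟩

theorem not_disjoint_layerStar_subset {n : ℕ} {o : Fin n} (M : ℕ) {L L' : Layer n}
    (h : ¬ Disjoint (layerStar o L) (layerStar o L')) :
    (∃ v, v ≠ o ∧ (L.1.1 ≤ M ∧ o ∈ L.2.1 ∧ v ∈ L.2.1) ∧ (L'.1.1 ≤ M ∧ o ∈ L'.2.1 ∧ v ∈ L'.2.1)) ∨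
      ((M < L.1.1 ∧ o ∈ L.2.1) ∧ o ∈ L'.2.1) ∨ (o ∈ L.2.1 ∧ (M < L'.1.1 ∧ o ∈ L'.2.1)) := by
  obtain ⟨e, he, he'⟩ := Finset.not_disjoint_iff.1 h
  simp only [layerStar_eq, starPairs, Finset.mem_filter, Finset.mem_univ, true_and] at he he'
  obtain ⟨⟨⟨hd, hV⟩, hoe⟩, -⟩ := he
  obtain ⟨⟨⟨-, hV'⟩, -⟩, -⟩ := he'
  obtain ⟨v, rfl⟩ := Sym2.mem_iff_exists.1 hoe
  have ho := hV o hoe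
  have ho' := hV' o hoe
  rcases lt_or_ge M L.1.1 with h1 | h1
  · exact Or.inr (Or.inl ⟨⟨h1, ho⟩, ho'⟩)
  rcases lt_or_ge M L'.1.1 with h2 | h2
  · exact Or.inr (Or.inr ⟨ho, h2, ho'⟩)
  · have hv : v ∈ s(o, v) := by simp
    exact Or.inl ⟨v, fun h => hd (by simp [h]), ⟨h1, ho, hV v hv⟩, h2, ho', hV' v hv⟩

theorem pi_real_overlapEvent_le {n m : ℕ} (o : Fin n) (ν : Measure (Layer n))
    [IsProbabilityMeasure ν] (M : ℕ) {a b c : ℝ}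
    (ha : ∀ v, v ≠ o → ν.real {L | L.1.1 ≤ M ∧ o ∈ L.2.1 ∧ v ∈ L.2.1} ≤ a)
    (hb : ν.real {L | M < L.1.1 ∧ o ∈ L.2.1} ≤ b) (hc : ν.real {L | o ∈ L.2.1} ≤ c) :
    (Measure.pi fun _ : Fin m => ν).real (overlapEvent n m o) ≤
      (m : ℝ) ^ 2 * (n * a ^ 2 + 2 * (b * c)) := by
  set μ := Measure.pi fun _ : Fin m => ν
  set A : Fin n → Set (Layer n) := fun v => {L | L.1.1 ≤ M ∧ o ∈ L.2.1 ∧ v ∈ L.2.1}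
  set B : Set (Layer n) := {L | M < L.1.1 ∧ o ∈ L.2.1}
  set C : Set (Layer n) := {L | o ∈ L.2.1}
  have hb0 : 0 ≤ b := measureReal_nonneg.trans hb
  have hc0 : 0 ≤ c := measureReal_nonneg.trans hc
  have hpair : ∀ k l : Fin m, k ≠ l →
      μ.real {ω | ¬ Disjoint (layerStar o (ω k)) (layerStar o (ω l))} ≤
        n * a ^ 2 + 2 * (b * c) := by
    intro k l hkl
    have hsub : {ω : Fin m → Layer n | ¬ Disjoint (layerStar o (ω k)) (layerStar o (ω l))} ⊆
        (⋃ v ∈ Finset.univ.erase o, {ω | ω k ∈ A v ∧ ω l ∈ A v}) ∪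
          ({ω | ω k ∈ B ∧ ω l ∈ C} ∪ {ω | ω k ∈ C ∧ ω l ∈ B}) := by
      intro ω hω
      rcases not_disjoint_layerStar_subset M hω with ⟨v, hv, h1, h2⟩ | h | h
      · refine Or.inl (Set.mem_biUnion (x := v) ?_ ⟨h1, h2⟩)
        simpa using hv
      · exact Or.inr (Or.inl h)
      · exact Or.inr (Or.inr h)
    refine (measureReal_mono hsub).trans ((measureReal_union_le _ _).trans (add_le_add ?_ ?_))
    · refine (measureReal_biUnion_finset_le _ _).trans ?_
      have hterm : ∀ v ∈ Finset.univ.erase o, μ.real {ω | ω k ∈ A v ∧ ω l ∈ A v} ≤ a ^ 2 := by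
        intro v hv
        have hv' := ha v (Finset.ne_of_mem_erase hv)
        rw [pi_real_pair ν hkl, sq]
        exact mul_le_mul hv' hv' measureReal_nonneg (measureReal_nonneg.trans hv')
      refine (Finset.sum_le_sum hterm).trans ?_
      rw [Finset.sum_const, nsmul_eq_mul]
      have : ((Finset.univ.erase o).card : ℝ) ≤ n := by
        have := (Finset.card_erase_le (s := Finset.univ) (a := o)).trans_eq
          (Finset.card_univ.trans (Fintype.card_fin n))
        exact_mod_cast this
      gcongr
    · refine (measureReal_union_le _ _).trans ?_
      rw [pi_real_pair ν hkl, pi_real_pair ν hkl, two_mul]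
      refine add_le_add (mul_le_mul hb hc measureReal_nonneg hb0) ?_
      rw [mul_comm b]
      exact mul_le_mul hc hb measureReal_nonneg hc0
  have hcover : overlapEvent n m o ⊆
      ⋃ kl ∈ (Finset.univ : Finset (Fin m)).offDiag,
        {ω | ¬ Disjoint (layerStar o (ω kl.1)) (layerStar o (ω kl.2))} := by
    rintro ω ⟨k, l, hkl, h⟩
    exact Set.mem_biUnion (x := (k, l)) (by simpa using hkl) h
  refine (measureReal_mono hcover (measure_ne_top _ _)).trans ((measureReal_biUnion_finset_le _ _).trans ?_)
  refine (Finset.sum_le_sum fun kl hkl =>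
    hpair kl.1 kl.2 (Finset.mem_offDiag.1 hkl).2.2).trans ?_
  rw [Finset.sum_const, nsmul_eq_mul]
  have hcard : ((Finset.univ : Finset (Fin m)).offDiag.card : ℝ) ≤ (m : ℝ) ^ 2 := by
    have : (Finset.univ : Finset (Fin m)).offDiag.card ≤ m ^ 2 := by
      rw [Finset.offDiag_card, Finset.card_univ, Fintype.card_fin, sq]
      exact Nat.sub_le _ _
    exact_mod_cast this
  gcongr

theorem tendsto_real_overlapEvent {mu : ℝ} {m : ℕ → ℕ}
    (hratio : Tendsto (fun n : ℕ => (m n : ℝ) / n) atTop (𝓝 mu))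
    {Pn : ℕ → ProbabilityMeasure (ℕ × ℝ)} {P : ProbabilityMeasure (ℕ × ℝ)}
    (hweak : Tendsto Pn atTop (𝓝 P))
    (hQ : ∀ n, ∀ᵐ p ∂(Pn n : Measure (ℕ × ℝ)), p.1 ≤ n)
    (hP : Integrable (fun p : ℕ × ℝ => (p.1 : ℝ)) (P : Measure (ℕ × ℝ)))
    (h10 : Tendsto (fun n => ∫ p, (p.1 : ℝ) ∂(Pn n : Measure (ℕ × ℝ))) atTop
      (𝓝 (∫ p, (p.1 : ℝ) ∂(P : Measure (ℕ × ℝ))))) :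
    Tendsto (fun n => (modelMeasure n (m n) (Pn n : Measure (ℕ × ℝ))).real
      (overlapEvent n (m n) 0)) atTop (𝓝 0) := by
  set E := ∫ p, (p.1 : ℝ) ∂(P : Measure (ℕ × ℝ))
  have hE : 0 ≤ E := integral_nonneg fun p => Nat.cast_nonneg _
  refine tendsto_order.2 ⟨fun a ha => .of_forall fun n => ha.trans_le measureReal_nonneg,
    fun δ hδ => ?_⟩
  set η := δ / (4 * mu ^ 2 * E + 1) with hη
  have hden : 0 < 4 * mu ^ 2 * E + 1 := by positivity
  have hη0 : 0 < η := div_pos hδ hden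
  obtain ⟨K, -, hK⟩ :=
    eventually_sizeTail_lt hweak (fun n => integrable_fst_of_le (hQ n)) hP h10 hη0
  have hlim : Tendsto (fun n : ℕ => ((m n : ℝ) / n) ^ 2 *
      (4 * ((2 * K : ℕ) : ℝ) ^ 4 * (1 / (n : ℝ)) + 4 * η * ∫ p, (p.1 : ℝ) ∂(Pn n : Measure (ℕ × ℝ)))) atTop
      (𝓝 (mu ^ 2 * (4 * ((2 * K : ℕ) : ℝ) ^ 4 * 0 + 4 * η * E))) :=
    (hratio.pow 2).mul ((tendsto_one_div_atTop_nhds_zero_nat.const_mul _).add (h10.const_mul _))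
  have hlt : mu ^ 2 * (4 * ((2 * K : ℕ) : ℝ) ^ 4 * 0 + 4 * η * E) < δ := by
    have : η * (4 * mu ^ 2 * E + 1) = δ := div_mul_cancel₀ _ hden.ne'
    linarith
  filter_upwards [hlim.eventually (gt_mem_nhds hlt), hK, eventually_ge_atTop 2] with n hn hKn hn2
  refine lt_of_le_of_lt ?_ hn
  have hn2' : (2 : ℝ) ≤ n := by exact_mod_cast hn2
  set o : Fin n := ⟨0, by omega⟩
  have ha : ∀ v, v ≠ o → (layerMeasure n (Pn n : Measure (ℕ × ℝ))).real
      {L | L.1.1 ≤ 2 * K ∧ o ∈ L.2.1 ∧ v ∈ L.2.1} ≤ 2 * ((2 * K : ℕ) : ℝ) ^ 2 / n ^ 2 := by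
    intro v hv
    refine (layerMeasure_real_pair_small_le hv.symm (hQ n) (2 * K)).trans ?_
    rw [div_le_div_iff₀ (by nlinarith) (by positivity)]
    have h0 : 0 ≤ ((2 * K : ℕ) : ℝ) ^ 2 := by positivity
    nlinarith [mul_nonneg h0 (by nlinarith : (0 : ℝ) ≤ 2 * (n * (n - 1)) - n ^ 2)]
  have hI : 0 ≤ ∫ p, (p.1 : ℝ) ∂(Pn n : Measure (ℕ × ℝ)) :=
    integral_nonneg fun p => Nat.cast_nonneg _
  have hb : (layerMeasure n (Pn n : Measure (ℕ × ℝ))).real {L | 2 * K < L.1.1 ∧ o ∈ L.2.1} ≤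
      2 * η / n :=
    (layerMeasure_real_mem_large_le o (hQ n) K).trans (by gcongr)
  refine (pi_real_overlapEvent_le o _ (2 * K) ha hb (layerMeasure_real_mem o (hQ n)).le).trans_eq ?_
  field_simp
  ring

theorem abs_real_deg_sub_le {n m : ℕ} (Q : Measure (ℕ × ℝ)) [IsProbabilityMeasure Q] (i s : ℕ) :
    |(modelMeasure n m Q).real {ω | deg ω i = s} -
      (modelMeasure n m Q).real {ω | ∑ k, (layerStar i (ω k)).card = s}| ≤
      (modelMeasure n m Q).real (overlapEvent n m i) := by
  have : IsProbabilityMeasure (modelMeasure n m Q) := by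
    unfold modelMeasure; infer_instance
  have key : ∀ A B : Set (Fin m → Layer n), A ⊆ B ∪ overlapEvent n m i →
      (modelMeasure n m Q).real A ≤
        (modelMeasure n m Q).real B + (modelMeasure n m Q).real (overlapEvent n m i) :=
    fun A B h => (measureReal_mono h).trans (measureReal_union_le _ _)
  have h1 := key {ω | deg ω i = s} {ω | ∑ k, (layerStar i (ω k)).card = s} fun ω hω => by
    by_cases h : ω ∈ overlapEvent n m i
    · exact Or.inr h
    · exact Or.inl ((deg_eq_sum_of_notMem_overlapEvent h).symm.trans hω)
  have h2 := key {ω | ∑ k, (layerStar i (ω k)).card = s} {ω | deg ω i = s} fun ω hω => by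
    by_cases h : ω ∈ overlapEvent n m i
    · exact Or.inr h
    · exact Or.inl ((deg_eq_sum_of_notMem_overlapEvent h).trans hω)
  rw [abs_le]
  constructor <;> linarith

/-- **Theorem 3.1 of [Bloznelis–Leskelä]**. If `m/n → μ ∈ (0,∞)`, `P⁽ⁿ⁾ → P` weakly and
`P⁽ⁿ⁾₁₀ → P₁₀ ∈ (0,∞)`, then the model degree distribution of `G_n` converges weakly to
the compound Poisson distribution `CPoi(μ P₁₀, g)`, i.e. the law of `H_1 + ⋯ + H_Λ` with
`Λ ~ Poi(μ P₁₀)` and the `H_k` i.i.d. with mass function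
`g(s) = ∫ Bin(x-1,y)(s) x P(dx,dy) / P₁₀`, independent of `Λ`. -/
theorem degree_tendsto_compound_poisson
    (mu : ℝ) (hmu : 0 < mu)
    (m : ℕ → ℕ) (hm : Tendsto m atTop atTop)
    (hratio : Tendsto (fun n : ℕ => (m n : ℝ) / n) atTop (𝓝 mu))
    (Pn : ℕ → ProbabilityMeasure (ℕ × ℝ)) (P : ProbabilityMeasure (ℕ × ℝ))
    (hsupp : ∀ n, (Pn n : Measure (ℕ × ℝ)) {p : ℕ × ℝ | p.1 ≤ n ∧ p.2 ∈ Set.Icc (0:ℝ) 1} = 1)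
    (hPsupp : (P : Measure (ℕ × ℝ)) {p : ℕ × ℝ | p.2 ∈ Set.Icc (0:ℝ) 1} = 1)
    (hweak : Tendsto Pn atTop (𝓝 P))
    (hint10 : Integrable (fun p : ℕ × ℝ => (p.1.descFactorial 1 : ℝ) * p.2 ^ (0:ℕ))
      (P : Measure (ℕ × ℝ)))
    (h10pos : 0 < mom (P : Measure (ℕ × ℝ)) 1 0)
    (h10 : Tendsto (fun n : ℕ => mom (Pn n : Measure (ℕ × ℝ)) 1 0) atTop
      (𝓝 (mom (P : Measure (ℕ × ℝ)) 1 0))) :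
    ∀ s : ℕ, Tendsto (fun n : ℕ =>
        ((modelMeasure n (m n) (Pn n : Measure (ℕ × ℝ))) {ω | deg ω 0 = s}).toReal) atTop
      (𝓝 (barf1 mu (P : Measure (ℕ × ℝ)) s)) := by
  intro s
  have hQ : ∀ n, ∀ᵐ p ∂(Pn n : Measure (ℕ × ℝ)), p.1 ≤ n ∧ p.2 ∈ Set.Icc (0 : ℝ) 1 := fun n =>
    (mem_ae_iff_prob_eq_one (((measurableSet_Iic (a := n)).preimage measurable_fst).inter
      (measurableSet_Icc.preimage measurable_snd))).2 (hsupp n)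
  have hy : ∀ᵐ p ∂(P : Measure (ℕ × ℝ)), p.2 ∈ Set.Icc (0 : ℝ) 1 :=
    (mem_ae_iff_prob_eq_one (measurableSet_Icc.preimage measurable_snd)).2 hPsupp
  have hx : ∀ n, ∀ᵐ p ∂(Pn n : Measure (ℕ × ℝ)), p.1 ≤ n := fun n => (hQ n).mono fun _ h => h.1
  have hyn : ∀ n, ∀ᵐ p ∂(Pn n : Measure (ℕ × ℝ)), p.2 ∈ Set.Icc (0 : ℝ) 1 :=
    fun n => (hQ n).mono fun _ h => h.2
  have hPn : ∀ n, Integrable (fun p : ℕ × ℝ => (p.1 : ℝ)) (Pn n : Measure (ℕ × ℝ)) :=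
    fun n => integrable_fst_of_le (hx n)
  have hP : Integrable (fun p : ℕ × ℝ => (p.1 : ℝ)) (P : Measure (ℕ × ℝ)) := by
    simpa using hint10
  set ε : ℕ → ℝ := fun n => mom (Pn n : Measure (ℕ × ℝ)) 1 0 / n
  have hε0 : ∀ n, 0 ≤ ε n := fun n => by
    simp only [ε, mom_one_zero]
    exact div_nonneg (integral_nonneg fun p => Nat.cast_nonneg _) (Nat.cast_nonneg _)
  have hε : Tendsto ε atTop (𝓝 0) := h10.div_atTop tendsto_natCast_atTop_atTop
  have hmε : Tendsto (fun n => (m n : ℝ) * ε n) atTop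
      (𝓝 (mu * mom (P : Measure (ℕ × ℝ)) 1 0)) :=
    (hratio.mul h10).congr fun n => by simp only [ε]; ring
  have hmix : Tendsto (fun n => convPow (fun t => (1 - ε n) * (if t = 0 then 1 else 0) +
      ε n * gInc (Pn n : Measure (ℕ × ℝ)) t) (m n) s) atTop
      (𝓝 (barf1 mu (P : Measure (ℕ × ℝ)) s)) :=
    tendsto_convPow_mixture hm hε0 hε hmε (fun n => gInc_nonneg (hyn n))
      (fun n => gInc_le_one (hyn n) (hPn n)) (tendsto_gInc hweak hyn hy hPn hP h10pos h10) s
  have hsum : Tendsto (fun n => (modelMeasure n (m n) (Pn n : Measure (ℕ × ℝ))).real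
      {ω | ∑ k, (layerStar 0 (ω k)).card = s}) atTop (𝓝 (barf1 mu (P : Measure (ℕ × ℝ)) s)) := by
    refine hmix.congr' ?_
    filter_upwards [h10.eventually (lt_mem_nhds h10pos), eventually_ge_atTop 1] with n hpos hn
    have hlaw : (fun t => (1 - ε n) * (if t = 0 then 1 else 0) +
        ε n * gInc (Pn n : Measure (ℕ × ℝ)) t) =
        fun t => (layerMeasure n (Pn n : Measure (ℕ × ℝ))).real {L | (layerStar 0 L).card = t} :=
      funext fun t => (layerMeasure_real_layerStar (⟨0, hn⟩ : Fin n) (hQ n) hpos t).symm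
    rw [hlaw]
    exact (pi_real_sum_eq_convPow _ (measurable_card_layerStar (⟨0, hn⟩ : Fin n)) (m n) s).symm
  have hover := tendsto_real_overlapEvent hratio hweak hx hP (by simpa only [mom_one_zero] using h10)
  have hdiff : Tendsto (fun n => (modelMeasure n (m n) (Pn n : Measure (ℕ × ℝ))).real
      {ω | deg ω 0 = s} - (modelMeasure n (m n) (Pn n : Measure (ℕ × ℝ))).real
      {ω | ∑ k, (layerStar 0 (ω k)).card = s}) atTop (𝓝 0) :=
    squeeze_zero_norm (fun n => abs_real_deg_sub_le _ 0 s) hover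
  simpa [Measure.real] using hdiff.add hsum
end
end

section
/- Assume m,n → ∞ with m/n → μ ∈ (0,∞), P^{(n)} → P weakly, and P^{(n)}_{10} → P_{10} ∈ (0,∞). Fix s,t ∈ ℕ. For M > 0, let d̂_1, d̂_2 denote the degrees of nodes 1 and 2 in the truncated graph Ĝ obtained by keeping only layers with X_{n,k} ≤ M, and let D_i = deg_{G_n}(i). Then (a) sup_n |P(D_1 = s, D_2 = t) − P(d̂_1 = s, d̂_2 = t)| → 0 as M → ∞, and (b) P(D_1 = s, D_2 = t) − P(D_1 = s) P(D_2 = t) → 0 as n → ∞. -/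
open MeasureTheory ProbabilityTheory Filter
open scoped ENNReal Topology Classical

noncomputable section

/-- The edge set of a layer, kept only if the layer size is at most `M`. -/
def layerEdgesTr {n : ℕ} (M : ℝ) (L : Layer n) : Finset (Sym2 (Fin n)) :=
  if (L.1.1 : ℝ) ≤ M then layerEdges L else ∅

/-- The edge set `E(Ĝ) = ⋃_{k : X_{n,k} ≤ M} E(G_{n,k})` of the truncated graph. -/
def graphEdgesTr {n m : ℕ} (M : ℝ) (ω : Fin m → Layer n) : Finset (Sym2 (Fin n)) :=
  Finset.univ.biUnion fun k => layerEdgesTr M (ω k)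

/-- The degree `d̂_i = deg_{Ĝ}(i)` in the truncated graph. -/
def degTr {n m : ℕ} (M : ℝ) (ω : Fin m → Layer n) (i : ℕ) : ℕ :=
  ((graphEdgesTr M ω).filter fun e => ∃ v : Fin n, v ∈ e ∧ (v : ℕ) = i).card

theorem choose_sub_mul_pow_le {n x k : ℕ} (hk : k ≤ x) (hx : x ≤ n) :
    (n - k).choose (x - k) * n ^ k ≤ x ^ k * n.choose x := by
  induction k with
  | zero => simp
  | succ k ih =>
    obtain ⟨a, rfl⟩ : ∃ a, x = a + k + 1 := ⟨x - (k + 1), by omega⟩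
    obtain ⟨b, rfl⟩ : ∃ b, n = b + k + 1 := ⟨n - (k + 1), by omega⟩
    have ih := ih (by omega)
    simp only [show b + k + 1 - k = b + 1 by omega, show a + k + 1 - k = a + 1 by omega] at ih
    simp only [show b + k + 1 - (k + 1) = b by omega, show a + k + 1 - (k + 1) = a by omega]
    have hstep : b.choose a * (b + k + 1) ≤ (a + k + 1) * (b + 1).choose (a + 1) := by
      refine Nat.le_of_mul_le_mul_left ?_ (Nat.succ_pos b)
      calc (b + 1) * (b.choose a * (b + k + 1))
          = (b + 1).choose (a + 1) * ((a + 1) * (b + k + 1)) := by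
            rw [← mul_assoc, Nat.add_one_mul_choose_eq, mul_assoc]
        _ ≤ (b + 1).choose (a + 1) * ((b + 1) * (a + k + 1)) := by
            refine Nat.mul_le_mul_left _ ?_
            have : a * k ≤ b * k := Nat.mul_le_mul_right _ (by omega)
            nlinarith
        _ = (b + 1) * ((a + k + 1) * (b + 1).choose (a + 1)) := by ring
    calc b.choose a * (b + k + 1) ^ (k + 1)
        = b.choose a * (b + k + 1) * (b + k + 1) ^ k := by ring
      _ ≤ (a + k + 1) * (b + 1).choose (a + 1) * (b + k + 1) ^ k := Nat.mul_le_mul_right _ hstep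
      _ = (a + k + 1) * ((b + 1).choose (a + 1) * (b + k + 1) ^ k) := by ring
      _ ≤ (a + k + 1) * ((a + k + 1) ^ k * (b + k + 1).choose (a + k + 1)) :=
          Nat.mul_le_mul_left _ ih
      _ = (a + k + 1) ^ (k + 1) * (b + k + 1).choose (a + k + 1) := by ring

theorem vertexMeasure_real_superset_le {n : ℕ} (x : ℕ) (S : Finset (Fin n)) :
    (vertexMeasure n x).real {V | S ⊆ V} ≤ ((x : ℝ) / n) ^ S.card := by
  rcases S.eq_empty_or_nonempty with rfl | hS
  · simp
  have hn : 0 < n := by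
    obtain ⟨v, -⟩ := hS
    exact v.pos
  have h0 : 0 ≤ ((x : ℝ) / n) ^ S.card := by positivity
  unfold vertexMeasure
  split_ifs with h
  · have hxn : x ≤ n := by simpa using Finset.powersetCard_nonempty.1 h
    rw [measureReal_def, PMF.toMeasure_uniformOfFinset_apply _ _ MeasurableSpace.measurableSet_top]
    simp only [Set.mem_ofPred_eq, ENNReal.toReal_div, ENNReal.toReal_natCast]
    by_cases hSx : S.card ≤ x
    · rw [Finset.card_filter_powersetCard_subset _ _ _ (Finset.subset_univ S) hSx,
        Finset.card_powersetCard, Finset.card_univ, Fintype.card_fin, div_pow,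
        div_le_div_iff₀ (by exact_mod_cast Nat.choose_pos hxn) (by positivity)]
      exact_mod_cast choose_sub_mul_pow_le hSx hxn
    · rw [Finset.filter_false_of_mem]
      · simpa using h0
      · intro V hV hSV
        exact hSx ((Finset.card_le_card hSV).trans (Finset.mem_powersetCard.1 hV).2.le)
  · rw [measureReal_def, Measure.dirac_apply' _ MeasurableSpace.measurableSet_top]
    simpa [hS.ne_empty] using h0

set_option linter.deprecated false in
theorem measurable_bern : Measurable bern := by
  refine Measure.measurable_of_measurable_coe _ fun s _ => ?_
  have hs : MeasurableSet s := s.toFinite.measurableSet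
  simp only [bern]
  simp_rw [PMF.toMeasure_apply_fintype]
  refine Finset.measurable_sum _ fun b _ => ?_
  by_cases hb : b ∈ s
  · simp only [Set.indicator_of_mem hb, PMF.bernoulli_apply]
    cases b <;> simp <;> fun_prop
  · simp [Set.indicator_of_notMem hb]

theorem measurable_edgeMeasure (n : ℕ) (V : Finset (Fin n)) : Measurable (edgeMeasure n V) := by
  refine Measure.measurable_of_measurable_coe _ fun s hs => ?_
  have hfac : ∀ e b, Measurable fun y => edgeFactor n V y e {b} := by
    intro e b
    unfold edgeFactor
    split_ifs
    · exact (Measure.measurable_coe (measurableSet_singleton b)).comp measurable_bern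
    · exact measurable_const
  have hsum : ∀ y, edgeMeasure n V y s =
      ∑ f ∈ s.toFinite.toFinset, ∏ e, edgeFactor n V y e {f e} := by
    intro y
    conv_lhs => rw [← s.toFinite.coe_toFinset, ← sum_measure_singleton]
    simp_rw [edgeMeasure, Measure.pi_singleton]
  simp_rw [hsum]
  exact Finset.measurable_sum _ fun f _ => Finset.measurable_prod _ fun e _ => hfac e _

theorem measurable_layer_kernel (n : ℕ) :
    Measurable fun xy : ℕ × ℝ => (vertexMeasure n xy.1).bind fun V =>
      (edgeMeasure n V xy.2).map fun f => ((xy, V, f) : Layer n) := by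
  refine Measure.measurable_of_measurable_coe _ fun s hs => ?_
  have hval : ∀ xy : ℕ × ℝ, ((vertexMeasure n xy.1).bind fun V =>
      (edgeMeasure n V xy.2).map fun f => ((xy, V, f) : Layer n)) s =
      ∑ V, ∑ f, s.indicator 1 ((xy, V, f) : Layer n) * edgeMeasure n V xy.2 {f} *
        vertexMeasure n xy.1 {V} := by
    intro xy
    rw [Measure.bind_apply hs Measurable.of_discrete.aemeasurable, lintegral_fintype]
    refine Finset.sum_congr rfl fun V _ => ?_
    have hg : Measurable fun f : Sym2 (Fin n) → Bool => ((xy, V, f) : Layer n) := by fun_prop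
    rw [← lintegral_indicator_one hs, lintegral_map (measurable_one.indicator hs) hg,
      lintegral_fintype, Finset.sum_mul]
  simp_rw [hval]
  refine Finset.measurable_sum _ fun V _ => Finset.measurable_sum _ fun f _ => ?_
  refine (Measurable.mul ?_ ?_).mul ?_
  · exact (measurable_one.indicator hs).comp (by fun_prop)
  · exact (Measure.measurable_coe (measurableSet_singleton f)).comp
      ((measurable_edgeMeasure n V).comp measurable_snd)
  · exact (Measurable.of_discrete (f := fun x => vertexMeasure n x {V})).comp measurable_fst

theorem layerMeasure_apply {n : ℕ} (Q : Measure (ℕ × ℝ)) {R : ℕ × ℝ → Finset (Fin n) → Prop}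
    (hR : ∀ V, MeasurableSet {xy | R xy V}) :
    layerMeasure n Q {L | R L.1 L.2.1} = ∫⁻ xy, vertexMeasure n xy.1 {V | R xy V} ∂Q := by
  have hs : MeasurableSet {L : Layer n | R L.1 L.2.1} := by
    have : {L : Layer n | R L.1 L.2.1} =
        ⋃ V, (fun L : Layer n => L.1) ⁻¹' {xy | R xy V} ∩ (fun L : Layer n => L.2.1) ⁻¹' {V} := by
      ext L; simp
    rw [this]
    exact MeasurableSet.iUnion fun V => ((hR V).preimage measurable_fst).inter
      ((measurableSet_singleton V).preimage (measurable_fst.comp measurable_snd))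
  rw [layerMeasure, Measure.bind_apply hs (measurable_layer_kernel n).aemeasurable]
  refine lintegral_congr fun xy => ?_
  rw [Measure.bind_apply hs Measurable.of_discrete.aemeasurable,
    ← lintegral_indicator_one MeasurableSpace.measurableSet_top]
  refine lintegral_congr fun V => ?_
  have hg : Measurable fun f : Sym2 (Fin n) → Bool => ((xy, V, f) : Layer n) := by fun_prop
  rw [Measure.map_apply hg hs]
  by_cases h : R xy V <;> simp [h]

instance inst_s10 (n : ℕ) (Q : Measure (ℕ × ℝ)) [IsProbabilityMeasure Q] :
    IsProbabilityMeasure (layerMeasure n Q) := by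
  refine ⟨?_⟩
  have := layerMeasure_apply (n := n) Q (R := fun _ _ => True) (by simp)
  simpa using this

/-- The expectation of the layer size restricted to layers larger than `M`. -/
def tailMean (Q : Measure (ℕ × ℝ)) (M : ℝ) : ℝ :=
  ∫ p, if M < (p.1 : ℝ) then (p.1 : ℝ) else 0 ∂Q

theorem integrable_of_size_le {Q : Measure (ℕ × ℝ)} [IsFiniteMeasure Q] {n : ℕ}
    (hQ : ∀ᵐ p ∂Q, p.1 ≤ n) (g : ℕ → ℝ) : Integrable (fun p : ℕ × ℝ => g p.1) Q := by
  refine Integrable.of_bound (C := ∑ k ∈ Finset.range (n + 1), ‖g k‖)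
    ((Measurable.of_discrete (f := g)).comp measurable_fst).aestronglyMeasurable ?_
  filter_upwards [hQ] with p hp
  exact Finset.single_le_sum (f := fun k => ‖g k‖) (fun _ _ => norm_nonneg _)
    (Finset.mem_range.2 (Nat.lt_succ_of_le hp))

theorem layerMeasure_real_le {n : ℕ} {Q : Measure (ℕ × ℝ)} [IsProbabilityMeasure Q]
    {R : ℕ × ℝ → Finset (Fin n) → Prop} (hR : ∀ V, MeasurableSet {xy | R xy V})
    {g : ℕ × ℝ → ℝ} (hg : Integrable g Q)
    (h : ∀ xy, (vertexMeasure n xy.1).real {V | R xy V} ≤ g xy) :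
    (layerMeasure n Q).real {L | R L.1 L.2.1} ≤ ∫ xy, g xy ∂Q := by
  have h0 : ∀ xy, 0 ≤ g xy := fun xy => measureReal_nonneg.trans (h xy)
  rw [measureReal_def, layerMeasure_apply Q hR]
  refine ENNReal.toReal_le_of_le_ofReal (integral_nonneg h0) ?_
  rw [ofReal_integral_eq_lintegral_ofReal hg (ae_of_all _ h0)]
  refine lintegral_mono fun xy => ?_
  rw [← ENNReal.ofReal_toReal (measure_ne_top (vertexMeasure n xy.1) {V | R xy V})]
  exact ENNReal.ofReal_le_ofReal (h xy)

theorem vertexMeasure_real_label_le {n : ℕ} (x i : ℕ) :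
    (vertexMeasure n x).real {V | ∃ v ∈ V, (v : ℕ) = i} ≤ (x : ℝ) / n := by
  by_cases hi : i < n
  · have := vertexMeasure_real_superset_le x {(⟨i, hi⟩ : Fin n)}
    simp only [Finset.card_singleton, pow_one, Finset.singleton_subset_iff] at this
    refine (measureReal_mono ?_).trans this
    rintro V ⟨v, hv, rfl⟩
    exact hv
  · have : {V : Finset (Fin n) | ∃ v ∈ V, (v : ℕ) = i} = ∅ := by
      ext V
      simp only [Set.mem_ofPred_eq, Set.mem_empty_iff_false, iff_false]
      rintro ⟨v, -, rfl⟩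
      exact hi v.isLt
    rw [this, measureReal_empty]
    positivity

theorem vertexMeasure_real_label_pair_le {n : ℕ} (x : ℕ) {i j : ℕ} (hij : i ≠ j) :
    (vertexMeasure n x).real {V | (∃ v ∈ V, (v : ℕ) = i) ∧ ∃ v ∈ V, (v : ℕ) = j} ≤
      ((x : ℝ) / n) ^ 2 := by
  by_cases h : i < n ∧ j < n
  · have := vertexMeasure_real_superset_le x {(⟨i, h.1⟩ : Fin n), ⟨j, h.2⟩}
    rw [Finset.card_pair (by simpa using hij)] at this
    refine (measureReal_mono ?_).trans this
    rintro V ⟨⟨v, hv, rfl⟩, w, hw, rfl⟩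
    simpa [Finset.insert_subset_iff] using ⟨hv, hw⟩
  · have : {V : Finset (Fin n) | (∃ v ∈ V, (v : ℕ) = i) ∧ ∃ v ∈ V, (v : ℕ) = j} = ∅ := by
      ext V
      simp only [Set.mem_ofPred_eq, Set.mem_empty_iff_false, iff_false]
      rintro ⟨⟨v, -, rfl⟩, w, -, rfl⟩
      exact h ⟨v.isLt, w.isLt⟩
    rw [this, measureReal_empty]
    positivity

/-- The edges of a layer incident to the node with label `i`. -/
def incidentEdges {n : ℕ} (i : ℕ) (L : Layer n) : Finset (Sym2 (Fin n)) :=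
  (layerEdges L).filter fun e => ∃ v : Fin n, v ∈ e ∧ (v : ℕ) = i

theorem exists_label_of_incidentEdges_ne_empty {n i : ℕ} {L : Layer n} (h : incidentEdges i L ≠ ∅) :
    ∃ v ∈ L.2.1, (v : ℕ) = i := by
  obtain ⟨e, he⟩ := Finset.nonempty_iff_ne_empty.2 h
  simp only [incidentEdges, layerEdges, Finset.mem_filter, Finset.mem_univ, true_and] at he
  obtain ⟨⟨-, -, hV⟩, v, hv, hi⟩ := he
  exact ⟨v, hV v hv, hi⟩

theorem deg_eq_card_biUnion_incidentEdges {n m : ℕ} (ω : Fin m → Layer n) (i : ℕ) :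
    deg ω i = (Finset.univ.biUnion fun k => incidentEdges i (ω k)).card := by
  unfold deg graphEdges incidentEdges
  rw [Finset.filter_biUnion]

theorem measurableSet_preimage_snd {n : ℕ} {β : Type*} (f : Layer n → β)
    (hf : ∀ L L' : Layer n, L.2 = L'.2 → f L = f L') (s : Set β) : MeasurableSet (f ⁻¹' s) := by
  have : f ⁻¹' s = (fun L : Layer n => L.2) ⁻¹' {q | f ((0, 0), q) ∈ s} := by
    ext L
    simp only [Set.mem_preimage, Set.mem_ofPred_eq]
    rw [hf L ((0, 0), L.2) rfl]
  rw [this]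
  exact (Set.toFinite _).measurableSet.preimage measurable_snd

theorem degTr_eq_of_forall {n m : ℕ} {M : ℝ} {ω : Fin m → Layer n} {i : ℕ}
    (h : ∀ k, ¬ (M < ((ω k).1.1 : ℝ) ∧ ∃ v ∈ (ω k).2.1, (v : ℕ) = i)) :
    degTr M ω i = deg ω i := by
  unfold degTr deg graphEdgesTr graphEdges
  rw [Finset.filter_biUnion, Finset.filter_biUnion]
  congr 1
  refine Finset.biUnion_congr rfl fun k _ => ?_
  unfold layerEdgesTr
  split_ifs with hk
  · rfl
  · have : incidentEdges i (ω k) = ∅ := by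
      by_contra hne
      exact h k ⟨not_le.1 hk, exists_label_of_incidentEdges_ne_empty hne⟩
    rw [Finset.filter_empty]
    exact this.symm

theorem abs_measureReal_sub_le {α : Type*} [MeasurableSpace α] (μ : Measure α) [IsFiniteMeasure μ]
    {s t e : Set α} (h : ∀ a, a ∉ e → (a ∈ s ↔ a ∈ t)) : |μ.real s - μ.real t| ≤ μ.real e := by
  have key : ∀ {s t : Set α}, (∀ a, a ∉ e → (a ∈ s ↔ a ∈ t)) → μ.real s ≤ μ.real t + μ.real e := by
    intro s t h
    refine (measureReal_mono ?_).trans (measureReal_union_le t e)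
    intro a ha
    by_cases hae : a ∈ e
    · exact Or.inr hae
    · exact Or.inl ((h a hae).1 ha)
  have h1 := key h
  have h2 := key fun a ha => (h a ha).symm
  rw [abs_le]
  constructor <;> linarith

theorem pi_real_exists_le {α : Type*} [MeasurableSpace α] (μ : Measure α) [IsProbabilityMeasure μ]
    (m : ℕ) {s : Set α} (hs : MeasurableSet s) :
    (Measure.pi fun _ : Fin m => μ).real {ω | ∃ k, ω k ∈ s} ≤ m * μ.real s := by
  have : {ω : Fin m → α | ∃ k, ω k ∈ s} =
      ⋃ k ∈ (Finset.univ : Finset (Fin m)), Function.eval k ⁻¹' s := by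
    ext ω; simp
  rw [this]
  refine (measureReal_biUnion_finset_le _ _).trans ?_
  have h : ∀ k, (Measure.pi fun _ : Fin m => μ).real (Function.eval k ⁻¹' s) = μ.real s := fun k =>
    (measurePreserving_eval (fun _ : Fin m => μ) k).measureReal_preimage hs.nullMeasurableSet
  simp [h]

theorem measurableSet_large_label {n : ℕ} (M : ℝ) (i : ℕ) :
    MeasurableSet {L : Layer n | M < (L.1.1 : ℝ) ∧ ∃ v ∈ L.2.1, (v : ℕ) = i} := by
  refine MeasurableSet.inter (s₁ := {L : Layer n | M < (L.1.1 : ℝ)}) ?_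
    (measurableSet_preimage_snd (fun L => L.2.1) (fun L L' h => by simp only [h])
      {V : Finset (Fin n) | ∃ v ∈ V, (v : ℕ) = i})
  exact measurableSet_lt measurable_const
    ((Measurable.of_discrete (f := fun x : ℕ => (x : ℝ))).comp (measurable_fst.comp measurable_fst))

theorem layerMeasure_real_large_label_le {n : ℕ} {Q : Measure (ℕ × ℝ)} [IsProbabilityMeasure Q]
    (hQ : ∀ᵐ p ∂Q, p.1 ≤ n) (M : ℝ) (i : ℕ) :
    (layerMeasure n Q).real {L | M < (L.1.1 : ℝ) ∧ ∃ v ∈ L.2.1, (v : ℕ) = i} ≤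
      tailMean Q M / n := by
  rw [tailMean, ← integral_div]
  refine layerMeasure_real_le
    (R := fun xy V => M < (xy.1 : ℝ) ∧ ∃ v ∈ V, (v : ℕ) = i) (fun V => ?_)
    (integrable_of_size_le hQ fun x => (if M < (x : ℝ) then (x : ℝ) else 0) / n) fun xy => ?_
  · exact (measurableSet_lt measurable_const
      ((Measurable.of_discrete (f := fun x : ℕ => (x : ℝ))).comp measurable_fst)).inter
      (MeasurableSet.const _)
  · by_cases h : M < (xy.1 : ℝ)
    · simpa [h] using vertexMeasure_real_label_le xy.1 i
    · simp [h]

theorem abs_model_sub_truncated_le {n : ℕ} (m : ℕ) {Q : Measure (ℕ × ℝ)} [IsProbabilityMeasure Q]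
    (hQ : ∀ᵐ p ∂Q, p.1 ≤ n) (M : ℝ) (s t : ℕ) :
    |(modelMeasure n m Q {ω | deg ω 0 = s ∧ deg ω 1 = t}).toReal -
      (modelMeasure n m Q {ω | degTr M ω 0 = s ∧ degTr M ω 1 = t}).toReal| ≤
      2 * ((m : ℝ) / n * tailMean Q M) := by
  let S : ℕ → Set (Layer n) := fun i => {L | M < (L.1.1 : ℝ) ∧ ∃ v ∈ L.2.1, (v : ℕ) = i}
  have hS : ∀ i, (modelMeasure n m Q).real {ω | ∃ k, ω k ∈ S i} ≤ (m : ℝ) / n * tailMean Q M := by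
    intro i
    refine (pi_real_exists_le (layerMeasure n Q) m (measurableSet_large_label M i)).trans ?_
    calc (m : ℝ) * (layerMeasure n Q).real (S i) ≤ m * (tailMean Q M / n) := by
          gcongr
          exact layerMeasure_real_large_label_le hQ M i
      _ = (m : ℝ) / n * tailMean Q M := by ring
  have : IsProbabilityMeasure (modelMeasure n m Q) := by unfold modelMeasure; infer_instance
  refine (abs_measureReal_sub_le (modelMeasure n m Q)
    (e := {ω | ∃ k, ω k ∈ S 0} ∪ {ω | ∃ k, ω k ∈ S 1}) fun ω hω => ?_).trans ?_
  · simp only [Set.mem_union, Set.mem_ofPred_eq, not_or, not_exists] at hω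
    simp only [Set.mem_ofPred_eq, degTr_eq_of_forall hω.1, degTr_eq_of_forall hω.2]
  · refine (measureReal_union_le _ _).trans ?_
    linarith [hS 0, hS 1]

theorem sum_abs_prod_sub_prod_le {β : Type*} [Fintype β] (p q : β → ℝ) (hp : ∀ x, 0 ≤ p x)
    (hq : ∀ x, 0 ≤ q x) (hp1 : ∑ x, p x = 1) (hq1 : ∑ x, q x = 1) (m : ℕ) :
    ∑ x : Fin m → β, |∏ k, p (x k) - ∏ k, q (x k)| ≤ m * ∑ x, |p x - q x| := by
  induction m with
  | zero => simp
  | succ m ih =>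
    have hQ : ∑ x : Fin m → β, ∏ k, q (x k) = 1 := by
      rw [← Fintype.sum_pow, hq1, one_pow]
    rw [← (Fin.consEquiv fun _ : Fin (m + 1) => β).sum_comp, Fintype.sum_prod_type]
    calc ∑ a, ∑ x : Fin m → β,
          |∏ k, p (Fin.consEquiv (fun _ => β) (a, x) k) -
            ∏ k, q (Fin.consEquiv (fun _ => β) (a, x) k)|
        ≤ ∑ a, ∑ x : Fin m → β, (p a * |∏ k, p (x k) - ∏ k, q (x k)| +
            |p a - q a| * ∏ k, q (x k)) := by
          refine Finset.sum_le_sum fun a _ => Finset.sum_le_sum fun x _ => ?_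
          simp only [Fin.prod_univ_succ, Fin.consEquiv_apply, Fin.cons_zero, Fin.cons_succ]
          calc |p a * ∏ k, p (x k) - q a * ∏ k, q (x k)|
              = |p a * (∏ k, p (x k) - ∏ k, q (x k)) + (p a - q a) * ∏ k, q (x k)| := by
                congr 1; ring
            _ ≤ _ := by
                refine (abs_add_le _ _).trans_eq ?_
                rw [abs_mul, abs_mul, abs_of_nonneg (hp a),
                  abs_of_nonneg (Finset.prod_nonneg fun k _ => hq (x k))]
      _ = ∑ x : Fin m → β, |∏ k, p (x k) - ∏ k, q (x k)| + ∑ a, |p a - q a| := by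
          simp_rw [Finset.sum_add_distrib, ← Finset.mul_sum, hQ, mul_one, ← Finset.sum_mul, hp1,
            one_mul]
      _ ≤ ((m + 1 : ℕ) : ℝ) * ∑ x, |p x - q x| := by
          push_cast
          linarith

/-- A signed array with vanishing row and column sums is controlled by its entries outside a
fixed row and column. -/
theorem sum_abs_le_of_marginals_eq_zero {α : Type*} [Fintype α] (r : α → α → ℝ) (z : α)
    (hrow : ∀ a, ∑ b, r a b = 0) (hcol : ∀ b, ∑ a, r a b = 0) :
    ∑ a, ∑ b, |r a b| ≤
      4 * ∑ a ∈ Finset.univ.erase z, ∑ b ∈ Finset.univ.erase z, |r a b| := by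
  have herow : ∀ a, |r a z| ≤ ∑ b ∈ Finset.univ.erase z, |r a b| := by
    intro a
    have h := hrow a
    rw [← Finset.add_sum_erase _ _ (Finset.mem_univ z)] at h
    rw [eq_neg_of_add_eq_zero_left h, abs_neg]
    exact Finset.abs_sum_le_sum_abs _ _
  have hecol : ∀ b, |r z b| ≤ ∑ a ∈ Finset.univ.erase z, |r a b| := by
    intro b
    have h := hcol b
    rw [← Finset.add_sum_erase _ _ (Finset.mem_univ z)] at h
    rw [eq_neg_of_add_eq_zero_left h, abs_neg]
    exact Finset.abs_sum_le_sum_abs _ _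
  have h1 : ∑ a ∈ Finset.univ.erase z, |r a z| ≤
      ∑ a ∈ Finset.univ.erase z, ∑ b ∈ Finset.univ.erase z, |r a b| :=
    Finset.sum_le_sum fun a _ => herow a
  have h2 : ∑ b ∈ Finset.univ.erase z, |r z b| ≤
      ∑ a ∈ Finset.univ.erase z, ∑ b ∈ Finset.univ.erase z, |r a b| := by
    rw [Finset.sum_comm]
    exact Finset.sum_le_sum fun b _ => hecol b
  have h3 : |r z z| ≤ ∑ a ∈ Finset.univ.erase z, |r a z| := hecol z
  rw [← Finset.add_sum_erase _ _ (Finset.mem_univ z),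
    ← Finset.add_sum_erase _ _ (Finset.mem_univ z)]
  simp_rw [← Finset.add_sum_erase (Finset.univ : Finset α) (fun b => |r _ b|) (Finset.mem_univ z)]
  rw [Finset.sum_add_distrib]
  linarith

section FiniteRange

variable {Ω α : Type*} [MeasurableSpace Ω]

theorem sum_measureReal_fiber (μ : Measure Ω) [IsFiniteMeasure μ] {f : Ω → α}
    (hf : ∀ s : Set α, MeasurableSet (f ⁻¹' s)) (T : Finset α) :
    ∑ a ∈ T, μ.real (f ⁻¹' {a}) = μ.real (f ⁻¹' T) := by
  rw [← measureReal_biUnion_finset (fun a _ b _ hab => Disjoint.preimage f (by simpa using hab))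
    fun a _ => hf {a}]
  congr 1
  ext ω
  simp

variable [Fintype α]

theorem pi_real_comp (μ : Measure Ω) [IsProbabilityMeasure μ] {f : Ω → α}
    (hf : ∀ s : Set α, MeasurableSet (f ⁻¹' s)) (m : ℕ) (Φ : (Fin m → α) → Prop) :
    (Measure.pi fun _ : Fin m => μ).real {ω | Φ fun k => f (ω k)} =
      ∑ x with Φ x, ∏ k, μ.real (f ⁻¹' {x k}) := by
  have hset : {ω : Fin m → Ω | Φ fun k => f (ω k)} =
      (fun (ω : Fin m → Ω) k => f (ω k)) ⁻¹' (Finset.univ.filter Φ : Finset (Fin m → α)) := by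
    ext ω; simp
  have hfib : ∀ x : Fin m → α, (fun (ω : Fin m → Ω) k => f (ω k)) ⁻¹' {x} =
      Set.univ.pi fun k => f ⁻¹' {x k} := by
    intro x; ext ω; simp [funext_iff]
  have hmeas : ∀ s : Set (Fin m → α),
      MeasurableSet ((fun (ω : Fin m → Ω) k => f (ω k)) ⁻¹' s) := by
    intro s
    rw [← Set.biUnion_preimage_singleton]
    refine s.toFinite.measurableSet_biUnion fun x _ => ?_
    rw [hfib]
    exact MeasurableSet.univ_pi fun k => hf _
  rw [hset, ← sum_measureReal_fiber _ hmeas]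
  refine Finset.sum_congr rfl fun x _ => ?_
  rw [hfib, measureReal_def, Measure.pi_pi, ENNReal.toReal_prod]
  rfl

theorem sum_abs_joint_sub_mul_le (μ : Measure Ω) [IsProbabilityMeasure μ] {f g : Ω → α}
    (hf : ∀ s : Set (α × α), MeasurableSet ((fun ω => (f ω, g ω)) ⁻¹' s)) (z : α) :
    ∑ c : α × α, |μ.real ((fun ω => (f ω, g ω)) ⁻¹' {c}) -
      μ.real (f ⁻¹' {c.1}) * μ.real (g ⁻¹' {c.2})| ≤
    4 * (μ.real {ω | f ω ≠ z ∧ g ω ≠ z} + μ.real {ω | f ω ≠ z} * μ.real {ω | g ω ≠ z}) := by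
  have hf1 : ∀ s : Set α, MeasurableSet (f ⁻¹' s) := fun s => by
    simpa [Set.preimage_preimage] using hf (Prod.fst ⁻¹' s)
  have hg1 : ∀ s : Set α, MeasurableSet (g ⁻¹' s) := fun s => by
    simpa [Set.preimage_preimage] using hf (Prod.snd ⁻¹' s)
  let pf : α → ℝ := fun a => μ.real (f ⁻¹' {a})
  let pg : α → ℝ := fun a => μ.real (g ⁻¹' {a})
  let p : α × α → ℝ := fun c => μ.real ((fun ω => (f ω, g ω)) ⁻¹' {c})
  let q : α × α → ℝ := fun c => pf c.1 * pg c.2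
  have hpf1 : ∑ a, pf a = 1 := by simp [pf, sum_measureReal_fiber μ hf1]
  have hpg1 : ∑ a, pg a = 1 := by simp [pg, sum_measureReal_fiber μ hg1]
  have hprow : ∀ a, ∑ b, p (a, b) = pf a := by
    intro a
    have h := sum_measureReal_fiber μ hf ({a} ×ˢ Finset.univ)
    rw [Finset.sum_product, Finset.sum_singleton] at h
    refine h.trans (congrArg μ.real ?_)
    ext ω; simp [eq_comm]
  have hpcol : ∀ b, ∑ a, p (a, b) = pg b := by
    intro b
    have h := sum_measureReal_fiber μ hf (Finset.univ ×ˢ {b})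
    simp only [Finset.sum_product, Finset.sum_singleton] at h
    refine h.trans (congrArg μ.real ?_)
    ext ω; simp [eq_comm]
  have hp0 : ∀ c, 0 ≤ p c := fun c => measureReal_nonneg
  have hpf0 : ∀ c, 0 ≤ pf c := fun c => measureReal_nonneg
  have hpg0 : ∀ c, 0 ≤ pg c := fun c => measureReal_nonneg
  have hq0 : ∀ c, 0 ≤ q c := fun c => mul_nonneg (hpf0 _) (hpg0 _)
  have hpE : ∑ a ∈ Finset.univ.erase z, ∑ b ∈ Finset.univ.erase z, p (a, b) =
      μ.real {ω | f ω ≠ z ∧ g ω ≠ z} := by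
    rw [← Finset.sum_product']
    refine (sum_measureReal_fiber μ hf _).trans (congrArg μ.real ?_)
    ext ω; simp
  have hpfE : ∑ a ∈ Finset.univ.erase z, pf a = μ.real {ω | f ω ≠ z} := by
    refine (sum_measureReal_fiber μ hf1 _).trans (congrArg μ.real ?_)
    ext ω; simp
  have hpgE : ∑ a ∈ Finset.univ.erase z, pg a = μ.real {ω | g ω ≠ z} := by
    refine (sum_measureReal_fiber μ hg1 _).trans (congrArg μ.real ?_)
    ext ω; simp
  change ∑ c, |p c - q c| ≤ _
  rw [Fintype.sum_prod_type]
  refine (sum_abs_le_of_marginals_eq_zero (fun a b => p (a, b) - q (a, b)) z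
    (fun a => ?_) fun b => ?_).trans ?_
  · simp only [q, Finset.sum_sub_distrib, hprow, ← Finset.mul_sum, hpg1, mul_one, sub_self]
  · simp only [q, Finset.sum_sub_distrib, hpcol, ← Finset.sum_mul, hpf1, one_mul, sub_self]
  · refine mul_le_mul_of_nonneg_left ?_ (by norm_num)
    rw [← hpE, ← hpfE, ← hpgE, Finset.sum_mul_sum, ← Finset.sum_add_distrib]
    refine Finset.sum_le_sum fun a _ => ?_
    rw [← Finset.sum_add_distrib]
    refine Finset.sum_le_sum fun b _ => (abs_sub _ _).trans ?_
    rw [abs_of_nonneg (hp0 _), abs_of_nonneg (hq0 _)]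

/-- Two statistics of an i.i.d. sequence are nearly independent when, for a single term, the
values on which they depend are simultaneously nontrivial with small probability. -/
theorem abs_pi_joint_sub_mul_le (μ : Measure Ω) [IsProbabilityMeasure μ] {f g : Ω → α}
    (hf : ∀ s : Set (α × α), MeasurableSet ((fun ω => (f ω, g ω)) ⁻¹' s)) (z : α) (m : ℕ)
    (Φ Ψ : (Fin m → α) → Prop) :
    |(Measure.pi fun _ : Fin m => μ).real {ω | Φ (fun k => f (ω k)) ∧ Ψ fun k => g (ω k)} -
      (Measure.pi fun _ : Fin m => μ).real {ω | Φ fun k => f (ω k)} *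
      (Measure.pi fun _ : Fin m => μ).real {ω | Ψ fun k => g (ω k)}| ≤
    m * (4 * (μ.real {ω | f ω ≠ z ∧ g ω ≠ z} + μ.real {ω | f ω ≠ z} * μ.real {ω | g ω ≠ z})) := by
  have hf1 : ∀ s : Set α, MeasurableSet (f ⁻¹' s) := fun s => by
    simpa [Set.preimage_preimage] using hf (Prod.fst ⁻¹' s)
  have hg1 : ∀ s : Set α, MeasurableSet (g ⁻¹' s) := fun s => by
    simpa [Set.preimage_preimage] using hf (Prod.snd ⁻¹' s)
  let pf : α → ℝ := fun a => μ.real (f ⁻¹' {a})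
  let pg : α → ℝ := fun a => μ.real (g ⁻¹' {a})
  let p : α × α → ℝ := fun c => μ.real ((fun ω => (f ω, g ω)) ⁻¹' {c})
  let q : α × α → ℝ := fun c => pf c.1 * pg c.2
  have hpf1 : ∑ a, pf a = 1 := by simp [pf, sum_measureReal_fiber μ hf1]
  have hpg1 : ∑ a, pg a = 1 := by simp [pg, sum_measureReal_fiber μ hg1]
  have hp1 : ∑ c, p c = 1 := by simp [p, sum_measureReal_fiber μ hf]
  have hq1 : ∑ c, q c = 1 := by
    rw [Fintype.sum_prod_type]
    simp only [q, ← Finset.mul_sum, hpg1, mul_one, hpf1]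
  have hp0 : ∀ c, 0 ≤ p c := fun c => measureReal_nonneg
  have hq0 : ∀ c, 0 ≤ q c := fun c => mul_nonneg measureReal_nonneg measureReal_nonneg
  have hprod : (∑ x with Φ x, ∏ k, pf (x k)) * (∑ y with Ψ y, ∏ k, pg (y k)) =
      ∑ x : Fin m → α × α with Φ (fun k => (x k).1) ∧ Ψ (fun k => (x k).2), ∏ k, q (x k) := by
    rw [Finset.sum_mul_sum, ← Finset.sum_product']
    symm
    refine Finset.sum_equiv (Equiv.arrowProdEquivProdArrow (Fin m) (fun _ => α) fun _ => α)
      (fun x => ?_) fun x _ => ?_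
    · simp [Equiv.arrowProdEquivProdArrow]
    · simp [Equiv.arrowProdEquivProdArrow, q, Finset.prod_mul_distrib]
  have hjoint : (Measure.pi fun _ : Fin m => μ).real
      {ω | Φ (fun k => f (ω k)) ∧ Ψ fun k => g (ω k)} =
      ∑ x : Fin m → α × α with Φ (fun k => (x k).1) ∧ Ψ (fun k => (x k).2), ∏ k, p (x k) :=
    (pi_real_comp μ hf m fun x => Φ (fun k => (x k).1) ∧ Ψ fun k => (x k).2).trans
      (Finset.sum_congr (Finset.filter_congr_decidable _ _ _) fun _ _ => rfl)
  have hmul : (Measure.pi fun _ : Fin m => μ).real {ω | Φ fun k => f (ω k)} *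
      (Measure.pi fun _ : Fin m => μ).real {ω | Ψ fun k => g (ω k)} =
      ∑ x : Fin m → α × α with Φ (fun k => (x k).1) ∧ Ψ (fun k => (x k).2), ∏ k, q (x k) := by
    rw [← hprod, pi_real_comp μ hf1 m Φ, pi_real_comp μ hg1 m Ψ]
  have hsum := sum_abs_prod_sub_prod_le p q hp0 hq0 hp1 hq1 m
  rw [hjoint, hmul, ← Finset.sum_sub_distrib]
  refine (Finset.abs_sum_le_sum_abs _ _).trans ?_
  refine (Finset.sum_le_sum_of_subset_of_nonneg (Finset.filter_subset _ _)
    fun _ _ _ => abs_nonneg _).trans (hsum.trans ?_)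
  exact mul_le_mul_of_nonneg_left (sum_abs_joint_sub_mul_le μ hf z) m.cast_nonneg

end FiniteRange

theorem measurableSet_layer_support (n : ℕ) :
    MeasurableSet {p : ℕ × ℝ | p.1 ≤ n ∧ p.2 ∈ Set.Icc (0:ℝ) 1} :=
  (measurableSet_le measurable_fst measurable_const).inter (measurableSet_Icc.preimage measurable_snd)

theorem tailMean_anti {Q : Measure (ℕ × ℝ)} [IsFiniteMeasure Q] {n : ℕ}
    (hQ : ∀ᵐ p ∂Q, p.1 ≤ n) {K M : ℝ} (hKM : K ≤ M) : tailMean Q M ≤ tailMean Q K := by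
  refine integral_mono (integrable_of_size_le hQ fun x => if M < (x : ℝ) then (x : ℝ) else 0)
    (integrable_of_size_le hQ fun x => if K < (x : ℝ) then (x : ℝ) else 0) fun p => ?_
  by_cases h : M < (p.1 : ℝ)
  · simp [h, hKM.trans_lt h]
  · simp only [h, if_false]
    split_ifs <;> positivity

theorem tailMean_eq_zero {Q : Measure (ℕ × ℝ)} {n : ℕ}
    (hQ : ∀ᵐ p ∂Q, p.1 ≤ n) {M : ℝ} (hM : n ≤ M) : tailMean Q M = 0 := by
  refine integral_eq_zero_of_ae ?_
  filter_upwards [hQ] with p hp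
  have : ¬ M < (p.1 : ℝ) := not_lt.2 ((Nat.cast_le.2 hp).trans hM)
  simp [this]

/-- The layer size, replaced by zero when it exceeds `K`. -/
def truncSize (K : ℕ) : BoundedContinuousFunction (ℕ × ℝ) ℝ :=
  BoundedContinuousFunction.ofNormedAddCommGroup
    (fun p : ℕ × ℝ => if (K : ℝ) < (p.1 : ℝ) then 0 else (p.1 : ℝ))
    ((continuous_of_discreteTopology (f := fun x : ℕ => if (K : ℝ) < (x : ℝ) then 0 else (x : ℝ))).comp
      continuous_fst)
    K fun p => by
      split_ifs with h
      · simp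
      · simpa using h

theorem truncSize_apply (K : ℕ) (p : ℕ × ℝ) :
    truncSize K p = if (K : ℝ) < (p.1 : ℝ) then 0 else (p.1 : ℝ) := rfl

theorem tailMean_eq_sub {Q : Measure (ℕ × ℝ)} [IsFiniteMeasure Q]
    (hQ : Integrable (fun p : ℕ × ℝ => (p.1 : ℝ)) Q) (K : ℕ) :
    tailMean Q K = mom Q 1 0 - ∫ p, truncSize K p ∂Q := by
  rw [mom_one_zero, ← integral_sub hQ ((truncSize K).integrable Q)]
  refine integral_congr_ae (ae_of_all _ fun p => ?_)
  simp only [truncSize_apply]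
  split_ifs <;> simp

/-- Weak convergence together with convergence of the mean layer size makes the layer sizes
uniformly integrable. -/
theorem exists_tailMean_le {Pn : ℕ → ProbabilityMeasure (ℕ × ℝ)} {P : ProbabilityMeasure (ℕ × ℝ)}
    (hQ : ∀ n, ∀ᵐ p ∂(Pn n : Measure (ℕ × ℝ)), p.1 ≤ n) (hweak : Tendsto Pn atTop (𝓝 P))
    (hint : Integrable (fun p : ℕ × ℝ => (p.1 : ℝ)) (P : Measure (ℕ × ℝ)))
    (h10 : Tendsto (fun n : ℕ => mom (Pn n : Measure (ℕ × ℝ)) 1 0) atTop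
      (𝓝 (mom (P : Measure (ℕ × ℝ)) 1 0))) {ε : ℝ} (hε : 0 < ε) :
    ∃ K : ℕ, ∀ᶠ n in atTop, tailMean (Pn n : Measure (ℕ × ℝ)) K ≤ ε := by
  have hP : Tendsto (fun K : ℕ => tailMean (P : Measure (ℕ × ℝ)) K) atTop (𝓝 0) := by
    have h : Tendsto (fun K : ℕ => ∫ p, truncSize K p ∂(P : Measure (ℕ × ℝ))) atTop
        (𝓝 (∫ p, (p.1 : ℝ) ∂(P : Measure (ℕ × ℝ)))) := by
      refine tendsto_integral_of_dominated_convergence (fun p => (p.1 : ℝ))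
        (fun K => ((truncSize K).integrable _).aestronglyMeasurable) hint
        (fun K => ae_of_all _ fun p => ?_) (ae_of_all _ fun p => ?_)
      · rw [truncSize_apply]
        split_ifs <;> simp
      · refine tendsto_const_nhds.congr' ?_
        filter_upwards [eventually_ge_atTop p.1] with K hK
        rw [truncSize_apply, if_neg (not_lt.2 (Nat.cast_le.2 hK))]
    simp_rw [tailMean_eq_sub hint, mom_one_zero]
    simpa using h.const_sub (∫ p, (p.1 : ℝ) ∂(P : Measure (ℕ × ℝ)))
  obtain ⟨K, hK⟩ := (hP.eventually_lt_const hε).exists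
  refine ⟨K, ?_⟩
  have hlim : Tendsto (fun n => tailMean (Pn n : Measure (ℕ × ℝ)) K) atTop
      (𝓝 (tailMean (P : Measure (ℕ × ℝ)) K)) := by
    simp_rw [tailMean_eq_sub hint, tailMean_eq_sub (integrable_of_size_le (hQ _) fun x => (x : ℝ))]
    exact h10.sub
      (ProbabilityMeasure.tendsto_iff_forall_integral_tendsto.1 hweak (truncSize K))
  filter_upwards [hlim.eventually_lt_const hK] with n hn using hn.le

theorem layerMeasure_real_label_le {n : ℕ} {Q : Measure (ℕ × ℝ)} [IsProbabilityMeasure Q]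
    (hQ : ∀ᵐ p ∂Q, p.1 ≤ n) (i : ℕ) :
    (layerMeasure n Q).real {L | incidentEdges i L ≠ ∅} ≤ mom Q 1 0 / n := by
  rw [mom_one_zero, ← integral_div]
  refine (measureReal_mono fun L hL => ?_).trans (layerMeasure_real_le
    (R := fun _ V => ∃ v ∈ V, (v : ℕ) = i) (fun V => MeasurableSet.const _)
    (integrable_of_size_le hQ fun x => (x : ℝ) / n) fun xy => vertexMeasure_real_label_le xy.1 i)
  exact exists_label_of_incidentEdges_ne_empty hL

theorem layerMeasure_real_label_pair_le {n : ℕ} {Q : Measure (ℕ × ℝ)} [IsProbabilityMeasure Q]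
    (hQ : ∀ᵐ p ∂Q, p.1 ≤ n) {i j : ℕ} (hij : i ≠ j) (K : ℕ) :
    (layerMeasure n Q).real {L | incidentEdges i L ≠ ∅ ∧ incidentEdges j L ≠ ∅} ≤
      ((K : ℝ) ^ 2 / n + tailMean Q K) / n := by
  have htail := integrable_of_size_le hQ fun x => if (K : ℝ) < (x : ℝ) then (x : ℝ) else 0
  have hpair : (layerMeasure n Q).real {L | incidentEdges i L ≠ ∅ ∧ incidentEdges j L ≠ ∅} ≤
      ∫ p, ((p.1 : ℝ) / n) ^ 2 ∂Q := by
    refine (measureReal_mono fun L hL => ?_).trans (layerMeasure_real_le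
      (R := fun _ V => (∃ v ∈ V, (v : ℕ) = i) ∧ ∃ v ∈ V, (v : ℕ) = j)
      (fun V => MeasurableSet.const _) (integrable_of_size_le hQ fun x => ((x : ℝ) / n) ^ 2)
      fun xy => vertexMeasure_real_label_pair_le xy.1 hij)
    exact ⟨exists_label_of_incidentEdges_ne_empty hL.1,
      exists_label_of_incidentEdges_ne_empty hL.2⟩
  calc _ ≤ ∫ p, ((p.1 : ℝ) / n) ^ 2 ∂Q := hpair
    _ ≤ ∫ p, ((K : ℝ) ^ 2 / n + if (K : ℝ) < (p.1 : ℝ) then (p.1 : ℝ) else 0) / n ∂Q := by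
      refine integral_mono_ae (integrable_of_size_le hQ fun x => ((x : ℝ) / n) ^ 2)
        (((integrable_const _).add htail).div_const _) ?_
      filter_upwards [hQ] with p hp
      rcases n.eq_zero_or_pos with rfl | hn
      · simp
      have hn' : (0 : ℝ) < n := Nat.cast_pos.2 hn
      have hp' : (p.1 : ℝ) ≤ n := Nat.cast_le.2 hp
      rw [div_pow, sq (n : ℝ), ← div_div]
      gcongr
      rw [div_le_iff₀ hn', add_mul, div_mul_cancel₀ _ hn'.ne']
      split_ifs with h
      · nlinarith [sq_nonneg (K : ℝ), Nat.cast_nonneg (α := ℝ) p.1]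
      · rw [zero_mul, add_zero]
        exact pow_le_pow_left₀ (Nat.cast_nonneg _) (not_lt.1 h) 2
    _ = ((K : ℝ) ^ 2 / n + tailMean Q K) / n := by
      rw [integral_div, integral_add (integrable_const _) htail, tailMean]
      simp

theorem abs_joint_sub_mul_le {n : ℕ} (m : ℕ) {Q : Measure (ℕ × ℝ)} [IsProbabilityMeasure Q]
    (hQ : ∀ᵐ p ∂Q, p.1 ≤ n) (K s t : ℕ) :
    |(modelMeasure n m Q {ω | deg ω 0 = s ∧ deg ω 1 = t}).toReal -
      (modelMeasure n m Q {ω | deg ω 0 = s}).toReal *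
        (modelMeasure n m Q {ω | deg ω 1 = t}).toReal| ≤
      4 * ((m : ℝ) / n * ((K : ℝ) ^ 2 / n + tailMean Q K + mom Q 1 0 ^ 2 / n)) := by
  have h := abs_pi_joint_sub_mul_le (layerMeasure n Q)
    (f := incidentEdges 0) (g := incidentEdges 1)
    (measurableSet_preimage_snd _ fun L L' h => by simp only [incidentEdges, layerEdges, h]) ∅ m
    (fun x => (Finset.univ.biUnion x).card = s) fun x => (Finset.univ.biUnion x).card = t
  simp only [← deg_eq_card_biUnion_incidentEdges] at h
  refine h.trans ?_
  have h01 := layerMeasure_real_label_pair_le hQ zero_ne_one K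
  have h0 := layerMeasure_real_label_le hQ 0
  have h1 := layerMeasure_real_label_le hQ 1
  have hmom : 0 ≤ mom Q 1 0 / n := measureReal_nonneg.trans h0
  calc _ ≤ (m : ℝ) * (4 * (((K : ℝ) ^ 2 / n + tailMean Q K) / n +
        mom Q 1 0 / n * (mom Q 1 0 / n))) := by
        gcongr
    _ = _ := by ring

/-- **Lemma 3** (Bloznelis–Karjalainen–Leskelä): `M` to infinity. Under the assumptions of
the compound Poisson limit theorem, with `D_i = deg_{G_n}(i)` and `d̂_i` the degrees in the
truncated graph keeping only layers of size at most `M`: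
(a) `sup_n |P(D₁ = s, D₂ = t) - P(d̂₁ = s, d̂₂ = t)| → 0` as `M → ∞`, and
(b) `P(D₁ = s, D₂ = t) - P(D₁ = s) P(D₂ = t) → 0` as `n → ∞`. -/
theorem truncation_and_asymptotic_independence
    (mu : ℝ) (hmu : 0 < mu)
    (m : ℕ → ℕ) (hm : Tendsto m atTop atTop)
    (hratio : Tendsto (fun n : ℕ => (m n : ℝ) / n) atTop (𝓝 mu))
    (Pn : ℕ → ProbabilityMeasure (ℕ × ℝ)) (P : ProbabilityMeasure (ℕ × ℝ))
    (hsupp : ∀ n, (Pn n : Measure (ℕ × ℝ)) {p : ℕ × ℝ | p.1 ≤ n ∧ p.2 ∈ Set.Icc (0:ℝ) 1} = 1)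
    (hPsupp : (P : Measure (ℕ × ℝ)) {p : ℕ × ℝ | p.2 ∈ Set.Icc (0:ℝ) 1} = 1)
    (hweak : Tendsto Pn atTop (𝓝 P))
    (hint10 : Integrable (fun p : ℕ × ℝ => (p.1.descFactorial 1 : ℝ) * p.2 ^ (0:ℕ))
      (P : Measure (ℕ × ℝ)))
    (h10pos : 0 < mom (P : Measure (ℕ × ℝ)) 1 0)
    (h10 : Tendsto (fun n : ℕ => mom (Pn n : Measure (ℕ × ℝ)) 1 0) atTop
      (𝓝 (mom (P : Measure (ℕ × ℝ)) 1 0)))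
    (s t : ℕ) :
    Tendsto (fun M : ℝ => ⨆ n : ℕ,
        |((modelMeasure n (m n) (Pn n : Measure (ℕ × ℝ)))
            {ω | deg ω 0 = s ∧ deg ω 1 = t}).toReal -
         ((modelMeasure n (m n) (Pn n : Measure (ℕ × ℝ)))
            {ω | degTr M ω 0 = s ∧ degTr M ω 1 = t}).toReal|)
      atTop (𝓝 0) ∧
    Tendsto (fun n : ℕ =>
        ((modelMeasure n (m n) (Pn n : Measure (ℕ × ℝ)))
            {ω | deg ω 0 = s ∧ deg ω 1 = t}).toReal -
        ((modelMeasure n (m n) (Pn n : Measure (ℕ × ℝ))) {ω | deg ω 0 = s}).toReal *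
        ((modelMeasure n (m n) (Pn n : Measure (ℕ × ℝ))) {ω | deg ω 1 = t}).toReal)
      atTop (𝓝 0) := by
  have hQ : ∀ n, ∀ᵐ p ∂(Pn n : Measure (ℕ × ℝ)), p.1 ≤ n := fun n =>
    Filter.mem_of_superset (mem_ae_iff.2
      ((prob_compl_eq_zero_iff (measurableSet_layer_support n)).2 (hsupp n))) fun _ hp => hp.1
  have hint : Integrable (fun p : ℕ × ℝ => (p.1 : ℝ)) (P : Measure (ℕ × ℝ)) := by
    simpa using hint10
  have htail := fun ε hε => exists_tailMean_le hQ hweak hint h10 (ε := ε) hε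
  constructor
  · rw [Metric.tendsto_atTop]
    intro ε hε
    obtain ⟨K, hK⟩ := htail (ε / (8 * mu)) (by positivity)
    have hlim : Tendsto (fun n : ℕ => 2 * ((m n : ℝ) / n * (ε / (8 * mu)))) atTop
        (𝓝 (2 * (mu * (ε / (8 * mu))))) := (hratio.mul_const _).const_mul 2
    have hlt : 2 * (mu * (ε / (8 * mu))) < ε / 2 := by
      field_simp
      linarith
    obtain ⟨N, hN⟩ := eventually_atTop.1 (hK.and (hlim.eventually_lt_const hlt))
    refine ⟨max K N, fun M hM => ?_⟩
    rw [Real.dist_0_eq_abs, abs_of_nonneg (Real.iSup_nonneg fun n => abs_nonneg _)]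
    refine lt_of_le_of_lt (Real.iSup_le (fun n => ?_) (by positivity)) (half_lt_self hε)
    refine (abs_model_sub_truncated_le (m n) (hQ n) M s t).trans ?_
    rcases lt_or_ge n N with hn | hn
    · have hnM : (n : ℝ) ≤ M := (Nat.cast_le.2 hn.le).trans ((le_max_right _ _).trans hM)
      rw [tailMean_eq_zero (hQ n) hnM, mul_zero, mul_zero]
      positivity
    · refine le_trans ?_ (hN n hn).2.le
      gcongr
      exact (tailMean_anti (hQ n) ((le_max_left _ _).trans hM)).trans (hN n hn).1
  · rw [Metric.tendsto_atTop']
    intro ε hε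
    obtain ⟨K, hK⟩ := htail (ε / (8 * mu)) (by positivity)
    have hlim : Tendsto (fun n : ℕ => 4 * ((m n : ℝ) / n * ((K : ℝ) ^ 2 / n + ε / (8 * mu) +
        mom (Pn n : Measure (ℕ × ℝ)) 1 0 ^ 2 / n))) atTop
        (𝓝 (4 * (mu * (0 + ε / (8 * mu) + 0)))) :=
      (hratio.mul (((tendsto_const_div_atTop_nhds_zero_nat _).add_const _).add
        ((h10.pow 2).div_atTop tendsto_natCast_atTop_atTop))).const_mul 4
    have hlt : 4 * (mu * (0 + ε / (8 * mu) + 0)) < ε := by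
      field_simp
      linarith
    obtain ⟨N, hN⟩ := eventually_atTop.1 (hK.and (hlim.eventually_lt_const hlt))
    refine ⟨N, fun n hn => ?_⟩
    rw [Real.dist_0_eq_abs]
    refine lt_of_le_of_lt ?_ (hN n hn.le).2
    refine (abs_joint_sub_mul_le (m n) (hQ n) K s t).trans ?_
    gcongr
    exact (hN n hn.le).1
end
end
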